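/- arXiv:1902.04714 — 11 statements merged into one kernel-verified Lean document; each statement's English description precedes it below -/
import Mathlib

section
/- Let (X_k)_{k≥1} be a sequence of Poisson random variables on a common probability space with means λ_k = E[X_k] > 0 such that (log k)/λ_k → 0 as k → ∞. Then X_k/λ_k → 1 almost surely as k → ∞. (No independence of the X_k is assumed.) -/
open MeasureTheory ProbabilityTheory Real Filter
open scoped NNReal

/-- The exponential moments of the Poisson distribution. -/
lemma hasSum_exp_mul_poisson (r : ℝ≥0) (t : ℝ) :
    HasSum (fun n : ℕ ↦ (exp (-r) * (r : ℝ) ^ n / (n.factorial : ℝ)) * exp (t * n))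
      (exp (r * (exp t - 1))) := by
  have h := (NormedSpace.expSeries_div_hasSum_exp ((r : ℝ) * exp t)).mul_left (exp (-(r : ℝ)))
  rw [← Real.exp_eq_exp_ℝ, ← Real.exp_add] at h
  rw [show (r : ℝ) * (exp t - 1) = -r + r * exp t by ring]
  refine (congrArg (HasSum · _) (funext fun n ↦ ?_)).mpr h
  rw [mul_pow, ← Real.exp_nat_mul, mul_comm t]
  ring

lemma integrable_exp_mul_poissonMeasure (r : ℝ≥0) (t : ℝ) :
    Integrable (fun n : ℕ ↦ exp (t * (n : ℝ))) (poissonMeasure r) := by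
  rw [integrable_poissonMeasure_iff]
  simpa using (hasSum_exp_mul_poisson r t).summable

lemma mgf_poissonMeasure (r : ℝ≥0) (t : ℝ) :
    mgf (fun n : ℕ ↦ (n : ℝ)) (poissonMeasure r) t = exp (r * (exp t - 1)) := by
  rw [mgf, integral_poissonMeasure]
  simpa using (hasSum_exp_mul_poisson r t).tsum_eq

lemma mgf_poissonMeasure_le (r : ℝ≥0) {t : ℝ} (ht : |t| ≤ 1) :
    mgf (fun n : ℕ ↦ (n : ℝ)) (poissonMeasure r) t ≤ exp (r * (t + t ^ 2)) := by
  rw [mgf_poissonMeasure]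
  gcongr
  linarith [(abs_le.1 (Real.abs_exp_sub_one_sub_id_le ht)).2]

/-- A two-sided Chernoff bound for the Poisson distribution. -/
lemma poissonMeasure_real_abs_sub_ge_le (r : ℝ≥0) {ε : ℝ} (hε : 0 ≤ ε) (hε' : ε ≤ 2) :
    (poissonMeasure r).real {n : ℕ | ε * r ≤ |(n : ℝ) - r|} ≤ 2 * exp (-(r * (ε ^ 2 / 4))) := by
  have upper := measure_ge_le_exp_mul_mgf (μ := poissonMeasure r) (X := fun n : ℕ ↦ (n : ℝ))
    ((1 + ε) * r) (t := ε / 2) (by positivity) (integrable_exp_mul_poissonMeasure r _)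
  have lower := measure_le_le_exp_mul_mgf (μ := poissonMeasure r) (X := fun n : ℕ ↦ (n : ℝ))
    ((1 - ε) * r) (t := -(ε / 2)) (by linarith) (integrable_exp_mul_poissonMeasure r _)
  have upper' := mgf_poissonMeasure_le r (t := ε / 2) (abs_le.2 ⟨by linarith, by linarith⟩)
  have lower' := mgf_poissonMeasure_le r (t := -(ε / 2)) (abs_le.2 ⟨by linarith, by linarith⟩)
  have hsub : {n : ℕ | ε * r ≤ |(n : ℝ) - r|} ⊆
      {n : ℕ | (1 + ε) * r ≤ (n : ℝ)} ∪ {n : ℕ | (n : ℝ) ≤ (1 - ε) * r} := by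
    intro n hn
    change ε * r ≤ |(n : ℝ) - r| at hn
    rcases le_abs.1 hn with h | h
    · left
      change (1 + ε) * r ≤ (n : ℝ)
      linarith
    · right
      change (n : ℝ) ≤ (1 - ε) * r
      linarith
  calc _ ≤ _ := measureReal_mono hsub
    _ ≤ _ := measureReal_union_le _ _
    _ ≤ exp (-(ε / 2) * ((1 + ε) * r)) * exp (r * (ε / 2 + (ε / 2) ^ 2)) +
        exp (-(-(ε / 2)) * ((1 - ε) * r)) * exp (r * (-(ε / 2) + (-(ε / 2)) ^ 2)) := by
      gcongr
      · exact upper.trans (by gcongr)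
      · exact lower.trans (by gcongr)
    _ = _ := by
      rw [← Real.exp_add, ← Real.exp_add, two_mul]
      ring_nf

lemma summable_exp_neg_mul_of_log_div_tendsto_zero {a : ℕ → ℝ} (ha : ∀ k, 0 < a k)
    (h : Tendsto (fun k : ℕ ↦ Real.log k / a k) atTop (nhds 0)) {c : ℝ} (hc : 0 < c) :
    Summable fun k ↦ exp (-(a k * c)) := by
  refine Summable.of_norm_bounded_eventually_nat
    (Real.summable_nat_pow_inv.2 one_lt_two) ?_
  filter_upwards [h.eventually_lt_const (half_pos hc), eventually_gt_atTop 0] with k hk hk0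
  have hk0' : (0 : ℝ) < k := by exact_mod_cast hk0
  rw [div_lt_iff₀ (ha k)] at hk
  rw [Real.norm_of_nonneg (exp_pos _).le, ← Real.exp_log (pow_pos hk0' 2), ← Real.exp_neg,
    Real.log_pow, Real.exp_le_exp]
  push_cast
  linarith

/-- If `(X_k)` is a sequence of Poisson random variables with means `λ_k > 0` such that
`(log k)/λ_k → 0`, then `X_k / λ_k → 1` almost surely. No independence is assumed. -/
theorem poisson_ratio_tendsto_one_ae
    {Ω : Type*} [MeasurableSpace Ω] (P : Measure Ω) [IsProbabilityMeasure P]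
    (X : ℕ → Ω → ℕ) (hX : ∀ k, Measurable (X k))
    (lam : ℕ → ℝ≥0) (hlam : ∀ k, 0 < lam k)
    (hlaw : ∀ k, Measure.map (X k) P = poissonMeasure (lam k))
    (hgrow : Tendsto (fun k : ℕ => Real.log k / (lam k : ℝ)) atTop (nhds 0)) :
    ∀ᵐ ω ∂P, Tendsto (fun k : ℕ => (X k ω : ℝ) / (lam k : ℝ)) atTop (nhds 1) := by
  have hpos : ∀ k, (0 : ℝ) < lam k := fun k ↦ NNReal.coe_pos.2 (hlam k)
  have key : ∀ m : ℕ, ∀ᵐ ω ∂P, ∀ᶠ k in atTop,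
      |(X k ω : ℝ) - lam k| < 1 / ((m : ℝ) + 1) * lam k := by
    intro m
    set ε : ℝ := 1 / ((m : ℝ) + 1)
    have hε : 0 < ε := Nat.one_div_pos_of_nat
    have hε' : ε ≤ 2 := by
      have : ε ≤ 1 := div_le_one_of_le₀ (by simp) (by positivity)
      linarith
    have hsum := (summable_exp_neg_mul_of_log_div_tendsto_zero hpos hgrow
      (by positivity : 0 < ε ^ 2 / 4)).mul_left 2
    have hfin : ∑' k, P (X k ⁻¹' {n : ℕ | ε * lam k ≤ |(n : ℝ) - lam k|}) ≠ ⊤ := by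
      refine ne_top_of_le_ne_top hsum.tsum_ofReal_ne_top (ENNReal.tsum_le_tsum fun k ↦ ?_)
      rw [← Measure.map_apply (hX k) .of_discrete, hlaw, ← ofReal_measureReal]
      exact ENNReal.ofReal_le_ofReal (poissonMeasure_real_abs_sub_ge_le _ hε.le hε')
    filter_upwards [ae_eventually_notMem hfin] with ω hω
    filter_upwards [hω] with k hk
    exact not_le.1 hk
  filter_upwards [ae_all_iff.2 key] with ω hω
  rw [Metric.tendsto_nhds]
  intro δ hδ
  obtain ⟨m, hm⟩ := exists_nat_one_div_lt hδ
  filter_upwards [hω m] with k hk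
  rw [Real.dist_eq, div_sub_one (hpos k).ne', abs_div, abs_of_pos (hpos k), div_lt_iff₀ (hpos k)]
  exact hk.trans (mul_lt_mul_of_pos_right hm (hpos k))
end

section
/- Let k : (0,∞) → ℝ be measurable, and suppose its Mellin transform ǩ(z) = ∫_0^∞ t^{−z−1} k(t) dt converges absolutely for all real z with τ₁ ≤ z ≤ τ₂, where −∞ < τ₁ < τ₂ < ∞. Let ξ ∈ (τ₁, τ₂), let ℓ be a slowly varying function at infinity, and let c ∈ ℝ with c·ǩ(ξ) ≠ 0. Let f : (0,∞) → ℝ be measurable such that f(x)/x^{τ₂} is bounded on every interval [a,∞) with a > 0, and f(x) = c·x^ξ·ℓ(1/x)·(1+o(1)) as x → 0⁺. Then ∫_0^∞ k(x/t) f(t) t^{−1} dt = c·ǩ(ξ)·x^ξ·ℓ(1/x)·(1+o(1)) as x → 0⁺. -/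
open MeasureTheory Real Filter Set

/-- A positive function on `(0,∞)` is slowly varying at infinity if `ℓ(ct)/ℓ(t) → 1`
as `t → ∞` for every `c > 0`. -/
def SlowlyVaryingAtTop (ℓ : ℝ → ℝ) : Prop :=
  (∀ x : ℝ, 0 < x → 0 < ℓ x) ∧
    ∀ c : ℝ, 0 < c → Tendsto (fun t => ℓ (c * t) / ℓ t) atTop (nhds 1)

/-- Uniform convergence theorem for measurable, additively slowly varying functions. -/
theorem exists_forall_abs_sub_le_of_tendsto_sub {h : ℝ → ℝ} (hm : Measurable h)
    (hs : ∀ u, Tendsto (fun x => h (x + u) - h x) atTop (nhds 0)) {ε : ℝ} (hε : 0 < ε) :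
    ∃ X : ℝ, ∀ x, X ≤ x → ∀ u ∈ Icc (0 : ℝ) 1, |h (x + u) - h x| ≤ ε := by
  have hmeas : ∀ x : ℝ, Measurable (fun v => min 1 |h (x + v) - h x|) := fun x => by fun_prop
  have hnonneg : ∀ x v : ℝ, 0 ≤ min 1 |h (x + v) - h x| := fun x v => by positivity
  have hint : ∀ x a b : ℝ,
      IntervalIntegrable (fun v => min 1 |h (x + v) - h x|) volume a b := fun x a b =>
    (intervalIntegrable_const (c := (1 : ℝ))).mono_fun' (hmeas x).aestronglyMeasurable
      (Eventually.of_forall fun v => by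
        beta_reduce
        rw [Real.norm_of_nonneg (hnonneg x v)]; exact min_le_left _ _)
  have hlim : Tendsto (fun x => ∫ v in (0 : ℝ)..2, min 1 |h (x + v) - h x|) atTop (nhds 0) := by
    have := intervalIntegral.tendsto_integral_filter_of_dominated_convergence
      (μ := volume) (a := 0) (b := 2) (l := atTop)
      (F := fun x v => min 1 |h (x + v) - h x|) (f := fun _ => 0) (fun _ => (1 : ℝ))
      (Eventually.of_forall fun x => (hmeas x).aestronglyMeasurable)
      (Eventually.of_forall fun x => Eventually.of_forall fun v _ => by
        rw [Real.norm_of_nonneg (hnonneg x v)]; exact min_le_left _ _)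
      intervalIntegrable_const
      (Eventually.of_forall fun v _ => by
        simpa using (tendsto_const_nhds (x := (1 : ℝ))).min (hs v).abs)
    simpa using this
  have hη : 0 < min 1 ε / 2 := by positivity
  obtain ⟨X, hX⟩ := eventually_atTop.1 (hlim.eventually (gt_mem_nhds hη))
  refine ⟨X, fun x hx u hu => ?_⟩
  have h1 := hX x hx
  have h2 := hX (x + u) (by linarith [hu.1])
  have hi2 : IntervalIntegrable (fun v => min 1 |h (x + u + (v - u)) - h (x + u)|)
      volume u (u + 1) := by
    simpa [add_comm] using (hint (x + u) 0 1).comp_sub_right u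
  have key : ∫ _ in u..(u + 1), min 1 |h (x + u) - h x| ≤
      ∫ v in u..(u + 1), (min 1 |h (x + v) - h x| +
        min 1 |h (x + u + (v - u)) - h (x + u)|) := by
    refine intervalIntegral.integral_mono_on (by linarith) intervalIntegrable_const
      ((hint x _ _).add hi2) fun v _ => ?_
    rw [show x + u + (v - u) = x + v by ring]
    have htri : |h (x + u) - h x| ≤ |h (x + v) - h x| + |h (x + v) - h (x + u)| := by
      rw [abs_sub_comm (h (x + v)) (h (x + u))]
      linarith [abs_sub_le (h (x + u)) (h (x + v)) (h x)]
    rcases min_cases 1 |h (x + v) - h x| with h3 | h3 <;>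
    rcases min_cases 1 |h (x + v) - h (x + u)| with h4 | h4 <;>
    rcases min_cases 1 |h (x + u) - h x| with h5 | h5 <;>
    linarith [abs_nonneg (h (x + v) - h x), abs_nonneg (h (x + v) - h (x + u))]
  rw [intervalIntegral.integral_add (hint x _ _) hi2,
    intervalIntegral.integral_comp_sub_right (fun v => min 1 |h (x + u + v) - h (x + u)|) u,
    intervalIntegral.integral_const] at key
  have m1 : ∫ v in u..(u + 1), min 1 |h (x + v) - h x| ≤
      ∫ v in (0 : ℝ)..2, min 1 |h (x + v) - h x| :=
    intervalIntegral.integral_mono_interval hu.1 (by linarith) (by linarith [hu.2])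
      (Eventually.of_forall fun v => hnonneg x v) (hint x _ _)
  have m2 : ∫ v in (u - u)..(u + 1 - u), min 1 |h (x + u + v) - h (x + u)| ≤
      ∫ v in (0 : ℝ)..2, min 1 |h (x + u + v) - h (x + u)| :=
    intervalIntegral.integral_mono_interval (by linarith) (by linarith) (by linarith)
      (Eventually.of_forall fun v => hnonneg (x + u) v) (hint (x + u) _ _)
  have hlt : min 1 |h (x + u) - h x| < min 1 ε := by
    simp only [add_sub_cancel_left, one_smul] at key m2
    linarith
  rcases lt_min_iff.1 hlt with ⟨ha, hb⟩
  rcases min_lt_iff.1 ha with h6 | h6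
  · exact absurd h6 (lt_irrefl _)
  · rw [min_eq_right h6.le] at hb
    exact hb.le

/-- Additive form of Potter's bound. -/
theorem exists_forall_abs_sub_le_mul_of_tendsto_sub {h : ℝ → ℝ} (hm : Measurable h)
    (hs : ∀ u, Tendsto (fun x => h (x + u) - h x) atTop (nhds 0)) {ε : ℝ} (hε : 0 < ε) :
    ∃ X : ℝ, ∀ x, X ≤ x → ∀ y, X ≤ y → |h y - h x| ≤ ε * (|y - x| + 1) := by
  obtain ⟨X, hX⟩ := exists_forall_abs_sub_le_of_tendsto_sub hm hs hε
  have hstep : ∀ (n : ℕ) (x : ℝ), X ≤ x → |h (x + n) - h x| ≤ ε * n := by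
    intro n x hx
    induction n with
    | zero => simp
    | succ n ih =>
      have h1 := hX (x + n) (by linarith [n.cast_nonneg (α := ℝ)]) 1 (by simp)
      have h2 := abs_sub_le (h (x + n + 1)) (h (x + n)) (h x)
      push_cast
      rw [← add_assoc]
      linarith
  have hle : ∀ x y, X ≤ x → x ≤ y → |h y - h x| ≤ ε * (|y - x| + 1) := by
    intro x y hx hxy
    have hnn : 0 ≤ y - x := by linarith
    have h1 := Nat.floor_le hnn
    have h2 := Nat.lt_floor_add_one (y - x)
    have h3 := hstep ⌊y - x⌋₊ x hx
    have h4 := hX (x + ⌊y - x⌋₊) (by linarith [(⌊y - x⌋₊).cast_nonneg (α := ℝ)])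
      (y - x - ⌊y - x⌋₊) ⟨by linarith, by linarith⟩
    rw [show x + (⌊y - x⌋₊ : ℝ) + (y - x - ⌊y - x⌋₊) = y by ring] at h4
    have h5 := abs_sub_le (h y) (h (x + ⌊y - x⌋₊)) (h x)
    rw [abs_of_nonneg hnn]
    have h6 := mul_le_mul_of_nonneg_left h1 hε.le
    linarith
  refine ⟨X, fun x hx y hy => ?_⟩
  rcases le_total x y with hxy | hxy
  · exact hle x y hx hxy
  · rw [abs_sub_comm (h y), abs_sub_comm y]
    exact hle y x hy hxy

/-- Potter's bound for measurable, eventually positive, slowly varying functions. -/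
theorem exists_potter_bound {L : ℝ → ℝ} (hm : Measurable L) (hpos : ∀ᶠ t in atTop, 0 < L t)
    (hs : ∀ a : ℝ, 0 < a → Tendsto (fun t => L (a * t) / L t) atTop (nhds 1))
    {δ : ℝ} (hδ : 0 < δ) :
    ∃ T : ℝ, 0 < T ∧ ∀ t, T ≤ t → 0 < L t ∧
      ∀ s, T ≤ s → L s ≤ exp (δ * (|log (s / t)| + 1)) * L t := by
  have hsub : ∀ u, Tendsto (fun x => log (L (exp (x + u))) - log (L (exp x))) atTop (nhds 0) := by
    intro u
    have h1 := ((hs (exp u) (exp_pos u)).comp tendsto_exp_atTop).log one_ne_zero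
    rw [log_one] at h1
    refine h1.congr' ?_
    have h2 : Tendsto (fun x => exp u * exp x) atTop atTop :=
      tendsto_exp_atTop.const_mul_atTop (exp_pos u)
    filter_upwards [tendsto_exp_atTop.eventually hpos, h2.eventually hpos] with x hx hx'
    simp only [Function.comp_apply]
    rw [log_div hx'.ne' hx.ne', add_comm x u, exp_add]
  obtain ⟨X, hX⟩ := exists_forall_abs_sub_le_mul_of_tendsto_sub
    (h := fun x => log (L (exp x))) (by fun_prop) hsub hδ
  obtain ⟨T, hT⟩ := eventually_atTop.1 hpos
  have hmax : 0 < max T (exp X) := lt_max_of_lt_right (exp_pos X)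
  refine ⟨max T (exp X), hmax, fun t ht => ?_⟩
  have ht0 : 0 < t := hmax.trans_le ht
  have hLt := hT t ((le_max_left _ _).trans ht)
  refine ⟨hLt, fun s hs => ?_⟩
  have hs0 : 0 < s := hmax.trans_le hs
  have hLs := hT s ((le_max_left _ _).trans hs)
  have h1 := hX (log t) ((le_log_iff_exp_le ht0).2 ((le_max_right _ _).trans ht))
    (log s) ((le_log_iff_exp_le hs0).2 ((le_max_right _ _).trans hs))
  simp only [exp_log ht0, exp_log hs0] at h1
  rw [log_div hs0.ne' ht0.ne', ← exp_log hLs]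
  nth_rewrite 1 [← exp_log hLt]
  rw [← exp_add, exp_le_exp]
  linarith [le_abs_self (log (L s) - log (L t))]

/-- `exp (δ |log u|)` is dominated by the sum of a positive and a negative power of `u`. -/
theorem exp_mul_abs_log_le_rpow_add_rpow {u δ p q : ℝ} (hu : 0 < u) (hp : δ ≤ p) (hq : δ ≤ q) :
    exp (δ * |log u|) ≤ u ^ p + u ^ (-q) := by
  rw [rpow_def_of_pos hu, rpow_def_of_pos hu]
  rcases le_total 0 (log u) with h | h
  · rw [abs_of_nonneg h]
    have : exp (δ * log u) ≤ exp (log u * p) := exp_le_exp.2 (by nlinarith)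
    linarith [exp_pos (log u * -q)]
  · rw [abs_of_nonpos h]
    have : exp (δ * -log u) ≤ exp (log u * -q) := exp_le_exp.2 (by nlinarith)
    linarith [exp_pos (log u * p)]

/-- Potter-type bound on `L (u * t) / L t`, valid for all `u > 0`, when `L` is moreover
controlled by a power near the origin. -/
theorem exists_abs_div_le_rpow_add_rpow {L : ℝ → ℝ} (hm : Measurable L)
    (hpos : ∀ᶠ t in atTop, 0 < L t)
    (hs : ∀ a : ℝ, 0 < a → Tendsto (fun t => L (a * t) / L t) atTop (nhds 1))
    {p q : ℝ} (hp : 0 < p) (hq : 0 < q)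
    (hb : ∀ T : ℝ, 0 < T → ∃ M : ℝ, ∀ t, 0 < t → t ≤ T → |L t| ≤ M * t ^ (-q)) :
    ∃ C : ℝ, ∀ᶠ t in atTop, ∀ u, 0 < u → |L (u * t) / L t| ≤ C * (u ^ p + u ^ (-q)) := by
  have hδ : 0 < min p q := lt_min hp hq
  obtain ⟨T, hT0, hT⟩ := exists_potter_bound hm hpos hs hδ
  obtain ⟨M, hM⟩ := hb T hT0
  set δ := min p q
  have hM0 : 0 ≤ M := by
    have h1 := (abs_nonneg _).trans (hM T hT0 le_rfl)
    exact nonneg_of_mul_nonneg_left h1 (rpow_pos_of_pos hT0 _)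
  have hLT := (hT T le_rfl).1
  refine ⟨max (exp δ) (M * exp δ * T ^ (-q) / L T), ?_⟩
  filter_upwards [eventually_ge_atTop T] with t ht u hu
  have ht0 : 0 < t := hT0.trans_le ht
  obtain ⟨hLt, hPt⟩ := hT t ht
  have hup : 0 < u ^ p := rpow_pos_of_pos hu _
  have huq : 0 < u ^ (-q) := rpow_pos_of_pos hu _
  rw [abs_div, abs_of_pos hLt, div_le_iff₀ hLt]
  rcases le_total T (u * t) with h | h
  · have h1 := hPt (u * t) h
    rw [abs_of_pos (hT _ h).1]
    refine h1.trans (mul_le_mul_of_nonneg_right ?_ hLt.le)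
    rw [mul_div_cancel_right₀ _ ht0.ne', mul_add, mul_one, exp_add, mul_comm]
    gcongr
    · exact le_max_left _ _
    · exact exp_mul_abs_log_le_rpow_add_rpow hu (min_le_left _ _) (min_le_right _ _)
  · have h1 := hM (u * t) (by positivity) h
    have h2 := hPt T le_rfl
    have h3 : exp (δ * (|log (T / t)| + 1)) ≤ exp δ * (T ^ (-q) * t ^ q) := by
      rw [mul_add, mul_one, exp_add, mul_comm]
      gcongr
      have hlog : log (T / t) ≤ 0 := log_nonpos (by positivity) ((div_le_one ht0).2 ht)
      rw [abs_of_nonpos hlog, log_div hT0.ne' ht0.ne', rpow_def_of_pos hT0,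
        rpow_def_of_pos ht0, ← exp_add, exp_le_exp]
      rw [log_div hT0.ne' ht0.ne'] at hlog
      nlinarith [min_le_right p q]
    have h4 : L T ≤ exp δ * (T ^ (-q) * t ^ q) * L t :=
      h2.trans (mul_le_mul_of_nonneg_right h3 hLt.le)
    have h5 : t ^ (-q) ≤ exp δ * T ^ (-q) / L T * L t := by
      have htq : t ^ (-q) * t ^ q = 1 := by rw [← rpow_add ht0]; simp
      rw [div_mul_eq_mul_div, le_div_iff₀ hLT]
      calc t ^ (-q) * L T ≤ t ^ (-q) * (exp δ * (T ^ (-q) * t ^ q) * L t) := by gcongr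
        _ = (t ^ (-q) * t ^ q) * (exp δ * T ^ (-q) * L t) := by ring
        _ = _ := by rw [htq, one_mul]
    calc |L (u * t)| ≤ M * (u * t) ^ (-q) := h1
      _ = M * u ^ (-q) * t ^ (-q) := by rw [mul_rpow hu.le ht0.le]; ring
      _ ≤ M * u ^ (-q) * (exp δ * T ^ (-q) / L T * L t) := by gcongr
      _ = (M * exp δ * T ^ (-q) / L T) * u ^ (-q) * L t := by ring
      _ ≤ max (exp δ) (M * exp δ * T ^ (-q) / L T) * (u ^ p + u ^ (-q)) * L t := by
        gcongr
        · exact le_max_right _ _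
        · linarith

/-- Abelian theorem for Mellin convolutions, written multiplicatively at infinity. -/
theorem tendsto_integral_rpow_mul_slowlyVarying {k L : ℝ → ℝ} (hk : Measurable k)
    {τ₁ τ₂ ξ : ℝ} (hξ₁ : τ₁ < ξ) (hξ₂ : ξ < τ₂)
    (h₁ : IntegrableOn (fun t => t ^ (-τ₁ - 1) * k t) (Ioi 0))
    (h₂ : IntegrableOn (fun t => t ^ (-τ₂ - 1) * k t) (Ioi 0))
    (hm : Measurable L) (hpos : ∀ᶠ t in atTop, 0 < L t)
    (hs : ∀ a : ℝ, 0 < a → Tendsto (fun t => L (a * t) / L t) atTop (nhds 1))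
    (hb : ∀ T : ℝ, 0 < T → ∃ M : ℝ, ∀ t, 0 < t → t ≤ T → |L t| ≤ M * t ^ (ξ - τ₂)) :
    Tendsto (fun t => ∫ u in Ioi (0 : ℝ), u ^ (-ξ - 1) * k u * (L (u * t) / L t)) atTop
      (nhds (∫ u in Ioi (0 : ℝ), u ^ (-ξ - 1) * k u)) := by
  obtain ⟨C, hC⟩ := exists_abs_div_le_rpow_add_rpow hm hpos hs (p := ξ - τ₁) (q := τ₂ - ξ)
    (by linarith) (by linarith) (by simpa only [neg_sub] using hb)
  refine tendsto_integral_filter_of_dominated_convergence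
    (fun u => C * (|u ^ (-τ₁ - 1) * k u| + |u ^ (-τ₂ - 1) * k u|)) ?_ ?_ ?_ ?_
  · exact Eventually.of_forall fun t => Measurable.aestronglyMeasurable (by fun_prop)
  · filter_upwards [hC] with t ht
    filter_upwards [self_mem_ae_restrict measurableSet_Ioi] with u hu
    have hu : 0 < u := hu
    rw [norm_mul, norm_mul, Real.norm_eq_abs, Real.norm_eq_abs, Real.norm_eq_abs, abs_mul,
      abs_mul, abs_of_pos (rpow_pos_of_pos hu _), abs_of_pos (rpow_pos_of_pos hu _),
      abs_of_pos (rpow_pos_of_pos hu _)]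
    have hx := rpow_pos_of_pos hu (-ξ - 1)
    calc u ^ (-ξ - 1) * |k u| * |L (u * t) / L t|
        ≤ u ^ (-ξ - 1) * |k u| * (C * (u ^ (ξ - τ₁) + u ^ (-(τ₂ - ξ)))) := by
          gcongr; exact ht u hu
      _ = C * (u ^ (-ξ - 1) * u ^ (ξ - τ₁) * |k u| +
            u ^ (-ξ - 1) * u ^ (-(τ₂ - ξ)) * |k u|) := by ring
      _ = _ := by
        rw [← rpow_add hu, ← rpow_add hu]
        ring_nf
  · exact (h₁.abs.add h₂.abs).const_mul C
  · filter_upwards [self_mem_ae_restrict measurableSet_Ioi] with u hu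
    simpa using (hs u hu).const_mul (u ^ (-ξ - 1) * k u)

/-- The substitution `u = x / t` in a Mellin convolution. -/
theorem integral_mellin_convolution_comm (k f : ℝ → ℝ) {x : ℝ} (hx : 0 < x) :
    ∫ t in Ioi (0 : ℝ), k (x / t) * f t * t⁻¹ = ∫ u in Ioi (0 : ℝ), k u * f (x / u) * u⁻¹ := by
  have h1 := integral_comp_rpow_Ioi (fun u => k (x * u) * f u⁻¹ * u⁻¹)
    (p := -1) (by norm_num)
  have h2 := integral_comp_mul_left_Ioi (fun u => k u * f (x / u) * u⁻¹) 0 hx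
  rw [mul_zero, smul_eq_mul] at h2
  rw [eq_inv_mul_iff_mul_eq₀ hx.ne', ← integral_const_mul] at h2
  rw [← h2]
  trans ∫ u in Ioi (0 : ℝ), k (x * u) * f u⁻¹ * u⁻¹
  · rw [← h1]
    refine setIntegral_congr_fun measurableSet_Ioi fun t ht => ?_
    have ht : 0 < t := ht
    simp only [smul_eq_mul, rpow_neg_one, inv_inv, div_eq_mul_inv, abs_neg, abs_one]
    rw [show (-1 - 1 : ℝ) = ((-2 : ℤ) : ℝ) by norm_num, rpow_intCast]
    field_simp
  · refine setIntegral_congr_fun measurableSet_Ioi fun t ht => ?_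
    have ht : 0 < t := ht
    simp only [div_mul_cancel_left₀ hx.ne']
    field_simp

/-- **Mellin-transform Abelian theorem at 0.** Let `k` be a measurable kernel whose Mellin
transform `ǩ(z) = ∫_0^∞ t^{−z−1} k(t) dt` converges absolutely on the strip `τ₁ ≤ z ≤ τ₂`,
let `ξ ∈ (τ₁, τ₂)`, `ℓ` slowly varying, `c` with `c·ǩ(ξ) ≠ 0`. If `f` is measurable,
`f(x)/x^{τ₂}` is bounded on every `[a,∞)` with `a > 0`, and `f(x) ~ c x^ξ ℓ(1/x)` as
`x → 0⁺`, then `∫_0^∞ k(x/t) f(t) t⁻¹ dt ~ c ǩ(ξ) x^ξ ℓ(1/x)` as `x → 0⁺`. -/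
theorem mellin_abelian_at_zero
    (k : ℝ → ℝ) (hk : Measurable k)
    (τ₁ τ₂ : ℝ) (hτ : τ₁ < τ₂)
    (hconv : ∀ z : ℝ, τ₁ ≤ z → z ≤ τ₂ →
      IntegrableOn (fun t => t ^ (-z - 1) * k t) (Set.Ioi 0))
    (ξ : ℝ) (hξ₁ : τ₁ < ξ) (hξ₂ : ξ < τ₂)
    (ℓ : ℝ → ℝ) (hℓ : SlowlyVaryingAtTop ℓ)
    (c : ℝ) (hck : c * (∫ t in Set.Ioi (0:ℝ), t ^ (-ξ - 1) * k t) ≠ 0)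
    (f : ℝ → ℝ) (hf : Measurable f)
    (hbound : ∀ a : ℝ, 0 < a → ∃ M : ℝ, ∀ x : ℝ, a ≤ x → |f x / x ^ τ₂| ≤ M)
    (hasymp : Tendsto (fun x => f x / (c * x ^ ξ * ℓ (1 / x)))
      (nhdsWithin 0 (Set.Ioi 0)) (nhds 1)) :
    Tendsto
      (fun x => (∫ t in Set.Ioi (0:ℝ), k (x / t) * f t * t⁻¹) /
        (c * (∫ t in Set.Ioi (0:ℝ), t ^ (-ξ - 1) * k t) * x ^ ξ * ℓ (1 / x)))
      (nhdsWithin 0 (Set.Ioi 0)) (nhds 1) := by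
  have hc : c ≠ 0 := left_ne_zero_of_mul hck
  have hK := right_ne_zero_of_mul hck
  set L : ℝ → ℝ := fun t => f t⁻¹ * t ^ ξ / c with hL
  have hLm : Measurable L := by fun_prop
  have hLℓ : Tendsto (fun t => L t / ℓ t) atTop (nhds 1) := by
    refine (hasymp.comp tendsto_inv_atTop_nhdsGT_zero).congr' ?_
    filter_upwards [eventually_gt_atTop 0] with t ht
    have hξt := (rpow_pos_of_pos ht ξ).ne'
    have hℓt := (hℓ.1 t ht).ne'
    simp only [Function.comp_apply, hL, one_div, inv_inv, inv_rpow ht.le]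
    field_simp
  have hpos : ∀ᶠ t in atTop, 0 < L t := by
    filter_upwards [hLℓ.eventually (lt_mem_nhds one_pos), eventually_gt_atTop 0] with t h ht
    exact (div_pos_iff_of_pos_right (hℓ.1 t ht)).1 h
  have hs : ∀ a : ℝ, 0 < a → Tendsto (fun t => L (a * t) / L t) atTop (nhds 1) := by
    intro a ha
    have h1 := ((hLℓ.comp (tendsto_id.const_mul_atTop ha)).mul (hℓ.2 a ha)).div hLℓ one_ne_zero
    rw [mul_one, div_one] at h1
    refine h1.congr' ?_
    filter_upwards [eventually_gt_atTop 0, hpos] with t ht hLt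
    have h2 := (hℓ.1 t ht).ne'
    have h3 := (hℓ.1 (a * t) (by positivity)).ne'
    simp only [Function.comp_apply, id, Pi.div_apply]
    field_simp
  have hb : ∀ T : ℝ, 0 < T → ∃ M : ℝ, ∀ t, 0 < t → t ≤ T → |L t| ≤ M * t ^ (ξ - τ₂) := by
    intro T hT
    obtain ⟨M, hM⟩ := hbound T⁻¹ (inv_pos.2 hT)
    refine ⟨M / |c|, fun t ht htT => ?_⟩
    have h1 := hM t⁻¹ (inv_anti₀ ht htT)
    have hξt := rpow_pos_of_pos ht ξ
    have hτt := rpow_pos_of_pos ht τ₂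
    rw [inv_rpow ht.le, div_inv_eq_mul, abs_mul, abs_of_pos hτt] at h1
    simp only [hL]
    rw [abs_div, abs_mul, abs_of_pos hξt, rpow_sub ht, div_mul_eq_mul_div]
    refine div_le_div_of_nonneg_right ?_ (abs_nonneg c)
    rw [mul_div_assoc', le_div_iff₀ hτt]
    linarith [mul_le_mul_of_nonneg_right h1 hξt.le]
  have hmain := tendsto_integral_rpow_mul_slowlyVarying hk hξ₁ hξ₂
    (hconv τ₁ le_rfl hτ.le) (hconv τ₂ hτ.le le_rfl) hLm hpos hs hb
  have hlim := (((hmain.div_const (∫ t in Ioi (0 : ℝ), t ^ (-ξ - 1) * k t)).mul hLℓ).comp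
    tendsto_inv_nhdsGT_zero)
  rw [div_self hK, mul_one] at hlim
  refine hlim.congr' ?_
  filter_upwards [self_mem_nhdsWithin, tendsto_inv_nhdsGT_zero.eventually hpos] with x hx hLx
  have hx : 0 < x := hx
  have hconvol : ∫ t in Ioi (0 : ℝ), k (x / t) * f t * t⁻¹ =
      c * x ^ ξ * L x⁻¹ *
        ∫ u in Ioi (0 : ℝ), u ^ (-ξ - 1) * k u * (L (u * x⁻¹) / L x⁻¹) := by
    rw [integral_mellin_convolution_comm k f hx, ← integral_const_mul]
    refine setIntegral_congr_fun measurableSet_Ioi fun u hu => ?_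
    have hu : 0 < u := hu
    have hfL : c * x ^ ξ * u ^ (-ξ) * L (u * x⁻¹) = f (x / u) := by
      have hξx := (rpow_pos_of_pos hx ξ).ne'
      have hξu := (rpow_pos_of_pos hu ξ).ne'
      simp only [hL]
      rw [mul_inv, inv_inv, mul_rpow hu.le (inv_pos.2 hx).le, inv_rpow hx.le, rpow_neg hu.le,
        div_eq_inv_mul x u]
      field_simp
    rw [← hfL, rpow_sub_one hu.ne']
    have hLx' := hLx.ne'
    generalize L x⁻¹ = a at hLx' ⊢
    field_simp
  have hξx := (rpow_pos_of_pos hx ξ).ne'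
  have hℓx := (hℓ.1 x⁻¹ (inv_pos.2 hx)).ne'
  simp only [Function.comp_apply, one_div, hconvol]
  field_simp
end

section
/- Let 0 < α < 1 and τ > α. Let ρ₀ : (0,∞) → [0,∞) be measurable and locally bounded on (0,∞), with tail ρ̄₀(x) = ∫_x^∞ ρ₀(w) dw satisfying ρ̄₀(x) ~ x^{−α} ℓ₁(1/x) as x → 0⁺, where ℓ₁ is slowly varying at infinity. Let f_Z be a locally bounded probability density function on (0,∞) whose cumulative distribution function F_Z(z) = ∫_0^z f_Z(s) ds satisfies F_Z(z) ~ z^τ ℓ₂(1/z) as z → 0⁺, where ℓ₂ is slowly varying at infinity. Define ρ(w) = ∫_0^∞ z f_Z(z) ρ₀(wz) dz. Assume that x·ρ(x) and f_Z(x) are bounded for all sufficiently large x, and that there exists β > τ with μ_β = ∫_0^∞ w^β ρ₀(w) dw < ∞. Then the tail ρ̄(x) = ∫_x^∞ ρ(w) dw satisfies: (i) ρ̄(x) ~ (∫_0^∞ z^{−α} f_Z(z) dz)·x^{−α} ℓ₁(1/x) as x → 0⁺, and (ii) ρ̄(x) ~ μ_τ·x^{−τ} ℓ₂(x) as x → ∞,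 where μ_τ = ∫_0^∞ w^τ ρ₀(w) dw. -/
open MeasureTheory Real Filter Set

/-- A function is locally bounded on `(0,∞)` if it is bounded on every compact
subinterval `[a,b]` with `a > 0`. -/
def LocallyBoundedOnPos (ℓ : ℝ → ℝ) : Prop :=
  ∀ a b : ℝ, 0 < a → Bornology.IsBounded (ℓ '' Set.Icc a b)

theorem rpow_le_two_rpow_abs {w : ℝ} (hw : 1 / 2 ≤ w) (hw1 : w ≤ 1) (r : ℝ) :
    w ^ r ≤ 2 ^ |r| := by
  rcases le_total 0 r with hr | hr
  · exact (rpow_le_one (by linarith) hw1 hr).trans (one_le_rpow (by norm_num) (abs_nonneg r))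
  · calc w ^ r ≤ (1 / 2 : ℝ) ^ r := rpow_le_rpow_of_nonpos (by norm_num) hw hr
      _ = 2 ^ |r| := by rw [abs_of_nonpos hr, one_div, inv_rpow (by norm_num), rpow_neg (by norm_num)]

/-- Potter-type bound near zero obtained by iterating a bound for halving the argument. -/
theorem potter_bound_of_half {g : ℝ → ℝ} {p K δ : ℝ} (hK : 0 ≤ K)
    (hhalf : ∀ x, 0 < x → x ≤ δ → g (1 / 2 * x) ≤ (1 / 2) ^ p * g x)
    (hloc : ∀ x, 0 < x → x ≤ δ → ∀ v, 1 / 2 ≤ v → v ≤ 1 → g (v * x) ≤ K * g x)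
    (hg : ∀ x, 0 < x → x ≤ δ → 0 ≤ g x)
    {x v : ℝ} (hx : 0 < x) (hxδ : x ≤ δ) (hv : 0 < v) (hv1 : v ≤ 1) :
    g (v * x) ≤ K * 2 ^ |p| * v ^ p * g x := by
  have hiter : ∀ n : ℕ, g ((1 / 2) ^ n * x) ≤ ((1 / 2 : ℝ) ^ n) ^ p * g x := by
    intro n
    induction n with
    | zero => simp
    | succ n ih =>
      have hpos : (0 : ℝ) < (1 / 2) ^ n * x := by positivity
      have hle : (1 / 2 : ℝ) ^ n * x ≤ δ :=
        (mul_le_of_le_one_left hx.le (pow_le_one₀ (by norm_num) (by norm_num))).trans hxδ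
      have h := hhalf _ hpos hle
      rw [pow_succ' (1 / 2 : ℝ) n, mul_assoc, mul_rpow (by norm_num) (by positivity), mul_assoc]
      exact h.trans (mul_le_mul_of_nonneg_left ih (by positivity))
  obtain ⟨n, hn, hn'⟩ := exists_nat_pow_near_of_lt_one hv hv1 (y := (1 / 2 : ℝ))
    (by norm_num) (by norm_num)
  have hq : (0 : ℝ) < (1 / 2) ^ n := by positivity
  set q : ℝ := (1 / 2) ^ n with hqdef
  have hw : 1 / 2 ≤ v / q := by
    rw [le_div_iff₀ hq]; rw [pow_succ'] at hn; exact hn.le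
  have hw1 : v / q ≤ 1 := (div_le_one hq).2 hn'
  have hqx : q * x ≤ δ :=
    (mul_le_of_le_one_left hx.le (pow_le_one₀ (by norm_num) (by norm_num))).trans hxδ
  have h1 := hloc (q * x) (by positivity) hqx _ hw hw1
  have h2 : v / q * (q * x) = v * x := by field_simp
  rw [h2] at h1
  have h3 : q ^ p ≤ 2 ^ |p| * v ^ p := by
    have h := rpow_le_two_rpow_abs hw hw1 (-p)
    rw [abs_neg, div_rpow hv.le hq.le, rpow_neg hv.le, rpow_neg hq.le] at h
    have hvp := rpow_pos_of_pos hv p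
    have hqp := rpow_pos_of_pos hq p
    have : (v ^ p)⁻¹ / (q ^ p)⁻¹ = q ^ p / v ^ p := by field_simp
    rw [this, div_le_iff₀ hvp] at h
    exact h
  calc g (v * x) ≤ K * g (q * x) := h1
    _ ≤ K * (q ^ p * g x) := mul_le_mul_of_nonneg_left (hiter n) hK
    _ ≤ K * (2 ^ |p| * v ^ p * g x) :=
      mul_le_mul_of_nonneg_left (mul_le_mul_of_nonneg_right h3 (hg x hx hxδ)) hK
    _ = _ := by ring

theorem tendsto_mul_nhdsGT_zero {c : ℝ} (hc : 0 < c) :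
    Tendsto (fun x : ℝ => c * x) (nhdsWithin 0 (Ioi 0)) (nhdsWithin 0 (Ioi 0)) := by
  refine tendsto_nhdsWithin_iff.2 ⟨?_, ?_⟩
  · have : Tendsto (fun x : ℝ => c * x) (nhds 0) (nhds (c * 0)) := tendsto_id.const_mul c
    rw [mul_zero] at this
    exact this.mono_left nhdsWithin_le_nhds
  · filter_upwards [self_mem_nhdsWithin] with x hx using mul_pos hc hx

theorem SlowlyVaryingAtTop.eventually_pos_of_tendsto {g ℓ : ℝ → ℝ} {p : ℝ}
    (hℓ : SlowlyVaryingAtTop ℓ)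
    (hg : Tendsto (fun x => g x / (x ^ p * ℓ (1 / x))) (nhdsWithin 0 (Ioi 0)) (nhds 1)) :
    ∀ᶠ x in nhdsWithin 0 (Ioi 0), 0 < g x := by
  filter_upwards [hg.eventually_const_lt zero_lt_one, self_mem_nhdsWithin] with x hx hx0
  have hpos : 0 < x ^ p * ℓ (1 / x) :=
    mul_pos (rpow_pos_of_pos hx0 p) (hℓ.1 _ (one_div_pos.2 hx0))
  exact (div_pos_iff_of_pos_right hpos).1 hx

theorem SlowlyVaryingAtTop.tendsto_ratio {g ℓ : ℝ → ℝ} {p : ℝ} (hℓ : SlowlyVaryingAtTop ℓ)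
    (hg : Tendsto (fun x => g x / (x ^ p * ℓ (1 / x))) (nhdsWithin 0 (Ioi 0)) (nhds 1))
    {c : ℝ} (hc : 0 < c) :
    Tendsto (fun x => g (c * x) / g x) (nhdsWithin 0 (Ioi 0)) (nhds (c ^ p)) := by
  have h1 := hg.comp (tendsto_mul_nhdsGT_zero hc)
  have h2 : Tendsto (fun x : ℝ => ℓ (c⁻¹ * x⁻¹) / ℓ x⁻¹) (nhdsWithin 0 (Ioi 0)) (nhds 1) :=
    (hℓ.2 c⁻¹ (inv_pos.2 hc)).comp tendsto_inv_nhdsGT_zero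
  have h3 := ((h1.div hg one_ne_zero).mul h2).const_mul (c ^ p)
  rw [div_one, one_mul, mul_one] at h3
  refine h3.congr' ?_
  filter_upwards [hℓ.eventually_pos_of_tendsto hg, self_mem_nhdsWithin] with x hgx hx
  have hx' : 0 < x := hx
  have e1 : (1 : ℝ) / (c * x) = c⁻¹ * x⁻¹ := by rw [one_div, mul_inv]
  have l1 := hℓ.1 (c⁻¹ * x⁻¹) (by positivity)
  have l2 := hℓ.1 x⁻¹ (by positivity)
  have r1 := rpow_pos_of_pos hx' p
  have r2 := rpow_pos_of_pos hc p
  simp only [Function.comp_apply, Pi.div_apply]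
  rw [e1, one_div x, mul_rpow hc.le hx'.le]
  generalize ℓ (c⁻¹ * x⁻¹) = a at l1 ⊢
  generalize ℓ x⁻¹ = b at l2 ⊢
  field_simp

theorem SlowlyVaryingAtTop.exists_half_le {g ℓ : ℝ → ℝ} {p q : ℝ} (hℓ : SlowlyVaryingAtTop ℓ)
    (hg : Tendsto (fun x => g x / (x ^ p * ℓ (1 / x))) (nhdsWithin 0 (Ioi 0)) (nhds 1))
    (hqp : q < p) :
    ∃ δ > 0, ∀ x, 0 < x → x ≤ δ → 0 < g x ∧ g (1 / 2 * x) ≤ (1 / 2) ^ q * g x := by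
  have hlt : (1 / 2 : ℝ) ^ p < (1 / 2) ^ q :=
    rpow_lt_rpow_of_exponent_gt (by norm_num) (by norm_num) hqp
  have h := (hℓ.eventually_pos_of_tendsto hg).and
    ((hℓ.tendsto_ratio hg (c := 1 / 2) (by norm_num)).eventually_lt_const hlt)
  obtain ⟨δ, hδ, hsub⟩ := mem_nhdsGT_iff_exists_Ioc_subset.1 h
  refine ⟨δ, hδ, fun x hx hxδ => ?_⟩
  obtain ⟨h1, h2⟩ := hsub ⟨hx, hxδ⟩
  exact ⟨h1, ((div_lt_iff₀ h1).1 h2).le⟩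

theorem SlowlyVaryingAtTop.exists_le_half {g ℓ : ℝ → ℝ} {p q : ℝ} (hℓ : SlowlyVaryingAtTop ℓ)
    (hg : Tendsto (fun x => g x / (x ^ p * ℓ (1 / x))) (nhdsWithin 0 (Ioi 0)) (nhds 1))
    (hpq : p < q) :
    ∃ δ > 0, ∀ x, 0 < x → x ≤ δ → 0 < g x ∧ (1 / 2) ^ q * g x ≤ g (1 / 2 * x) := by
  have hlt : (1 / 2 : ℝ) ^ q < (1 / 2) ^ p :=
    rpow_lt_rpow_of_exponent_gt (by norm_num) (by norm_num) hpq
  have h := (hℓ.eventually_pos_of_tendsto hg).and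
    ((hℓ.tendsto_ratio hg (c := 1 / 2) (by norm_num)).eventually_const_lt hlt)
  obtain ⟨δ, hδ, hsub⟩ := mem_nhdsGT_iff_exists_Ioc_subset.1 h
  refine ⟨δ, hδ, fun x hx hxδ => ?_⟩
  obtain ⟨h1, h2⟩ := hsub ⟨hx, hxδ⟩
  exact ⟨h1, ((lt_div_iff₀ h1).1 h2).le⟩

theorem integrableOn_rpow_mul_Ioc_of_dyadic {h : ℝ → ℝ} {δ C q r : ℝ} (hδ : 0 < δ)
    (hh : ∀ z, 0 < z → 0 ≤ h z)
    (hint : ∀ a, 0 < a → IntegrableOn h (Ioc a δ))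
    (hbound : ∀ n : ℕ, ∫ z in Ioc ((1 / 2) ^ (n + 1) * δ) ((1 / 2) ^ n * δ), h z
      ≤ C * ((1 / 2) ^ n) ^ q)
    (hrq : 0 < q + r) :
    IntegrableOn (fun z => z ^ r * h z) (Ioc 0 δ) := by
  set S : ℕ → Set ℝ := fun n => Ioc ((1 / 2) ^ (n + 1) * δ) ((1 / 2) ^ n * δ) with hS
  have hpow_pos : ∀ n : ℕ, (0 : ℝ) < (1 / 2) ^ n * δ := fun n => by positivity
  have hSint : ∀ n, IntegrableOn h (S n) := fun n =>
    (hint _ (hpow_pos (n + 1))).mono_set (Ioc_subset_Ioc_right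
      (mul_le_of_le_one_left hδ.le (pow_le_one₀ (by norm_num) (by norm_num))))
  have hcover : Ioc 0 δ ⊆ ⋃ n, S n := by
    intro z hz
    obtain ⟨n, hn, hn'⟩ := exists_nat_pow_near_of_lt_one (x := z / δ) (y := (1 / 2 : ℝ))
      (div_pos hz.1 hδ) ((div_le_one hδ).2 hz.2) (by norm_num) (by norm_num)
    exact mem_iUnion.2 ⟨n, (lt_div_iff₀ hδ).1 hn, (div_le_iff₀ hδ).1 hn'⟩
  have hweight : ∀ n, ∀ z ∈ S n, z ^ r ≤ 2 ^ |r| * δ ^ r * ((1 / 2) ^ n) ^ r := by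
    intro n z hz
    have hp := hpow_pos n
    have hz0 : 0 < z := (hpow_pos (n + 1)).trans hz.1
    have hw : 1 / 2 ≤ z / ((1 / 2) ^ n * δ) := by
      rw [le_div_iff₀ hp, ← mul_assoc, ← pow_succ']; exact hz.1.le
    have h1 := rpow_le_two_rpow_abs hw ((div_le_one hp).2 hz.2) r
    rw [div_rpow hz0.le hp.le, div_le_iff₀ (rpow_pos_of_pos hp r),
      mul_rpow (by positivity) hδ.le] at h1
    linarith
  have hzS : ∀ n, ∀ z ∈ S n, 0 < z := fun n z hz => (hpow_pos (n + 1)).trans hz.1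
  have hdomint : ∀ n, IntegrableOn (fun z => 2 ^ |r| * δ ^ r * ((1 / 2) ^ n) ^ r * h z) (S n) :=
    fun n => (hSint n).const_mul _
  have hle : ∀ n, ∀ z ∈ S n, ‖z ^ r * h z‖ ≤ 2 ^ |r| * δ ^ r * ((1 / 2) ^ n) ^ r * h z := by
    intro n z hz
    have h0 := hzS n z hz
    rw [norm_of_nonneg (mul_nonneg (rpow_nonneg h0.le r) (hh z h0))]
    exact mul_le_mul_of_nonneg_right (hweight n z hz) (hh z h0)
  have hSm : ∀ n, MeasurableSet (S n) := fun n => measurableSet_Ioc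
  have hSint' : ∀ n, IntegrableOn (fun z => z ^ r * h z) (S n) := by
    intro n
    refine Integrable.mono' (hdomint n) ?_ ((ae_restrict_iff' (hSm n)).2 (ae_of_all _ (hle n)))
    exact ((measurable_id.pow_const r).aestronglyMeasurable).mul (hSint n).aestronglyMeasurable
  refine (integrableOn_iUnion_of_summable_integral_norm hSint' ?_).mono_set hcover
  have hgeom : Summable (fun n : ℕ => 2 ^ |r| * δ ^ r * C * ((1 / 2 : ℝ) ^ (q + r)) ^ n) :=
    (summable_geometric_of_lt_one (by positivity)
      (rpow_lt_one (by norm_num) (by norm_num) hrq)).mul_left _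
  refine Summable.of_nonneg_of_le (fun n => integral_nonneg fun z => norm_nonneg _) (fun n => ?_)
    hgeom
  calc ∫ z in S n, ‖z ^ r * h z‖
      ≤ ∫ z in S n, 2 ^ |r| * δ ^ r * ((1 / 2) ^ n) ^ r * h z :=
        setIntegral_mono_on (hSint' n).norm (hdomint n) (hSm n) (hle n)
    _ = 2 ^ |r| * δ ^ r * ((1 / 2) ^ n) ^ r * ∫ z in S n, h z := integral_const_mul _ _
    _ ≤ 2 ^ |r| * δ ^ r * ((1 / 2) ^ n) ^ r * (C * ((1 / 2) ^ n) ^ q) :=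
        mul_le_mul_of_nonneg_left (hbound n) (by positivity)
    _ = 2 ^ |r| * δ ^ r * C * ((1 / 2 : ℝ) ^ (q + r)) ^ n := by
        rw [← rpow_natCast ((1 / 2 : ℝ) ^ (q + r)), ← rpow_mul (by norm_num), mul_comm (q + r),
          rpow_mul (by norm_num), rpow_natCast, rpow_add (by positivity)]
        ring

theorem ofReal_mul_lintegral_Ioi_comp_mul {φ : ℝ → ENNReal} {x z : ℝ} (hz : 0 < z) :
    ENNReal.ofReal z * ∫⁻ w in Ioi x, φ (w * z) = ∫⁻ u in Ioi (x * z), φ u := by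
  have himg : (fun w : ℝ => w * z) '' Ioi x = Ioi (x * z) := by
    simpa only [mul_comm] using Set.image_mul_left_Ioi hz x
  rw [← himg, lintegral_image_eq_lintegral_abs_deriv_mul measurableSet_Ioi
    (f' := fun _ => z) (fun w _ => by simpa using (hasDerivWithinAt_id w (Ioi x)).mul_const z)
    (fun a _ b _ hab => mul_right_cancel₀ hz.ne' hab) φ, abs_of_pos hz,
    lintegral_const_mul' _ _ ENNReal.ofReal_ne_top]

theorem lintegral_scale_mixture {f k : ℝ → ℝ} (hf : Measurable f) (hk : Measurable k)
    (hf0 : ∀ z, 0 < z → 0 ≤ f z) (x : ℝ) :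
    ∫⁻ w in Ioi x, ∫⁻ z in Ioi 0, ENNReal.ofReal (z * f z * k (w * z)) =
      ∫⁻ z in Ioi 0, ENNReal.ofReal (f z) * ∫⁻ u in Ioi (x * z), ENNReal.ofReal (k u) := by
  rw [lintegral_lintegral_swap (by fun_prop)]
  refine setLIntegral_congr_fun measurableSet_Ioi fun z hz => ?_
  have hz' : 0 < z := hz
  rw [← ofReal_mul_lintegral_Ioi_comp_mul hz', ← mul_assoc,
    ← ENNReal.ofReal_mul (hf0 z hz'), ← lintegral_const_mul' _ _ ENNReal.ofReal_ne_top]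
  refine lintegral_congr fun w => ?_
  rw [← ENNReal.ofReal_mul (mul_nonneg (hf0 z hz') hz'.le), mul_comm z]

theorem lintegral_mul_tail_eq_lintegral_mul_cdf {φ ψ : ℝ → ENNReal} (hφ : Measurable φ)
    (hψ : Measurable ψ) {x : ℝ} (hx : 0 < x) :
    ∫⁻ z in Ioi 0, φ z * ∫⁻ u in Ioi (x * z), ψ u =
      ∫⁻ u in Ioi 0, ψ u * ∫⁻ z in Ioc 0 (u * x⁻¹), φ z := by
  have hmeas : MeasurableSet {p : ℝ × ℝ | x * p.1 < p.2} :=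
    measurableSet_lt (by fun_prop) (by fun_prop)
  have hleft : ∀ z ∈ Ioi (0 : ℝ), φ z * ∫⁻ u in Ioi (x * z), ψ u =
      ∫⁻ u in Ioi 0, {p : ℝ × ℝ | x * p.1 < p.2}.indicator (fun p => φ p.1 * ψ p.2) (z, u) := by
    intro z hz
    have hz' : 0 < z := hz
    rw [← lintegral_const_mul _ hψ]
    have hsub : Ioi (x * z) ⊆ Ioi 0 := Ioi_subset_Ioi (by positivity)
    rw [← inter_eq_left.2 hsub, ← setLIntegral_indicator measurableSet_Ioi]
    rfl
  have hright : ∀ u ∈ Ioi (0 : ℝ), ψ u * ∫⁻ z in Ioc 0 (u * x⁻¹), φ z =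
      ∫⁻ z in Ioi 0, {p : ℝ × ℝ | x * p.1 < p.2}.indicator (fun p => φ p.1 * ψ p.2) (z, u) := by
    intro u _
    rw [← lintegral_const_mul _ hφ, ← setLIntegral_congr Ioo_ae_eq_Ioc,
      ← Ioi_inter_Iio, inter_comm, ← setLIntegral_indicator measurableSet_Iio]
    refine lintegral_congr fun z => ?_
    have : z < u * x⁻¹ ↔ x * z < u := by
      rw [← div_eq_mul_inv, lt_div_iff₀ hx, mul_comm]
    simp only [Set.indicator, mem_Iio, mem_ofPred_eq, this, mul_comm (ψ u)]
  rw [setLIntegral_congr_fun measurableSet_Ioi hleft,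
    setLIntegral_congr_fun measurableSet_Ioi hright]
  refine lintegral_lintegral_swap (f := fun z u =>
    {p : ℝ × ℝ | x * p.1 < p.2}.indicator (fun p => φ p.1 * ψ p.2) (z, u)) ?_
  exact (Measurable.indicator (by fun_prop) hmeas).aemeasurable

theorem setIntegral_scale_mixture_eq_toReal {f k ρ : ℝ → ℝ} (hf : Measurable f)
    (hk : Measurable k) (hf0 : ∀ z, 0 < z → 0 ≤ f z) (hk0 : ∀ w, 0 < w → 0 ≤ k w)
    (hρ : ∀ w, 0 < w → ρ w = ∫ z in Ioi (0 : ℝ), z * f z * k (w * z)) {x : ℝ} (hx : 0 < x)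
    (hfin : ∫⁻ w in Ioi x, ∫⁻ z in Ioi 0, ENNReal.ofReal (z * f z * k (w * z)) ≠ ⊤) :
    ∫ w in Ioi x, ρ w =
      (∫⁻ w in Ioi x, ∫⁻ z in Ioi 0, ENNReal.ofReal (z * f z * k (w * z))).toReal := by
  have hmeas : Measurable fun w : ℝ => ∫⁻ z in Ioi 0, ENNReal.ofReal (z * f z * k (w * z)) :=
    Measurable.lintegral_prod_right' (f := fun p : ℝ × ℝ =>
      ENNReal.ofReal (p.2 * f p.2 * k (p.1 * p.2))) (by fun_prop)
  rw [← integral_toReal hmeas.aemeasurable (ae_lt_top hmeas hfin)]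
  refine setIntegral_congr_fun measurableSet_Ioi fun w hw => ?_
  have hw' : 0 < w := hx.trans hw
  rw [hρ w hw', integral_eq_lintegral_of_nonneg_ae]
  · refine (ae_restrict_iff' measurableSet_Ioi).2 (ae_of_all _ fun z hz => ?_)
    have hz' : 0 < z := hz
    exact mul_nonneg (mul_nonneg hz'.le (hf0 z hz')) (hk0 _ (mul_pos hw' hz'))
  · exact Measurable.aestronglyMeasurable (by fun_prop)

theorem setIntegral_scale_mixture_eq_tail {f k ρ : ℝ → ℝ} (hf : Measurable f)
    (hk : Measurable k) (hf0 : ∀ z, 0 < z → 0 ≤ f z) (hk0 : ∀ w, 0 < w → 0 ≤ k w)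
    (hkint : ∀ x, 0 < x → IntegrableOn k (Ioi x))
    (hρ : ∀ w, 0 < w → ρ w = ∫ z in Ioi (0 : ℝ), z * f z * k (w * z)) {x : ℝ} (hx : 0 < x)
    (hint : IntegrableOn (fun z => f z * ∫ u in Ioi (z * x), k u) (Ioi 0)) :
    ∫ w in Ioi x, ρ w = ∫ z in Ioi 0, f z * ∫ u in Ioi (z * x), k u := by
  have hnn : ∀ z, 0 < z → 0 ≤ ∫ u in Ioi (z * x), k u := fun z hz =>
    setIntegral_nonneg measurableSet_Ioi fun u hu => hk0 u ((mul_pos hz hx).trans hu)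
  have hae : 0 ≤ᵐ[volume.restrict (Ioi 0)] fun z => f z * ∫ u in Ioi (z * x), k u :=
    (ae_restrict_iff' measurableSet_Ioi).2 (ae_of_all _ fun z hz =>
      mul_nonneg (hf0 z hz) (hnn z hz))
  have heq : ∫⁻ w in Ioi x, ∫⁻ z in Ioi 0, ENNReal.ofReal (z * f z * k (w * z)) =
      ∫⁻ z in Ioi 0, ENNReal.ofReal (f z * ∫ u in Ioi (z * x), k u) := by
    rw [lintegral_scale_mixture hf hk hf0]
    refine setLIntegral_congr_fun measurableSet_Ioi fun z hz => ?_
    have hz' : 0 < z := hz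
    rw [ENNReal.ofReal_mul (hf0 z hz'), mul_comm x z,
      ofReal_integral_eq_lintegral_ofReal (hkint _ (mul_pos hz' hx))
        ((ae_restrict_iff' measurableSet_Ioi).2 (ae_of_all _ fun u hu =>
          hk0 u ((mul_pos hz' hx).trans hu)))]
  rw [setIntegral_scale_mixture_eq_toReal hf hk hf0 hk0 hρ hx, heq,
    integral_eq_lintegral_of_nonneg_ae hae hint.aestronglyMeasurable]
  rw [heq, ← ofReal_integral_eq_lintegral_ofReal hint hae]
  exact ENNReal.ofReal_ne_top

theorem setIntegral_scale_mixture_eq_cdf {f k ρ : ℝ → ℝ} (hf : Measurable f)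
    (hk : Measurable k) (hf0 : ∀ z, 0 < z → 0 ≤ f z) (hk0 : ∀ w, 0 < w → 0 ≤ k w)
    (hfint : IntegrableOn f (Ioi 0))
    (hρ : ∀ w, 0 < w → ρ w = ∫ z in Ioi (0 : ℝ), z * f z * k (w * z)) {x : ℝ} (hx : 0 < x)
    (hint : IntegrableOn (fun u => k u * ∫ z in Ioc 0 (u * x⁻¹), f z) (Ioi 0)) :
    ∫ w in Ioi x, ρ w = ∫ u in Ioi 0, k u * ∫ z in Ioc 0 (u * x⁻¹), f z := by
  have hnn : ∀ u, 0 ≤ ∫ z in Ioc 0 (u * x⁻¹), f z := fun u =>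
    setIntegral_nonneg measurableSet_Ioc fun z hz => hf0 z hz.1
  have hae : 0 ≤ᵐ[volume.restrict (Ioi 0)] fun u => k u * ∫ z in Ioc 0 (u * x⁻¹), f z :=
    (ae_restrict_iff' measurableSet_Ioi).2 (ae_of_all _ fun u hu =>
      mul_nonneg (hk0 u hu) (hnn u))
  have heq : ∫⁻ w in Ioi x, ∫⁻ z in Ioi 0, ENNReal.ofReal (z * f z * k (w * z)) =
      ∫⁻ u in Ioi 0, ENNReal.ofReal (k u * ∫ z in Ioc 0 (u * x⁻¹), f z) := by
    rw [lintegral_scale_mixture hf hk hf0,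
      lintegral_mul_tail_eq_lintegral_mul_cdf (φ := fun z => ENNReal.ofReal (f z))
        (ψ := fun u => ENNReal.ofReal (k u)) (by fun_prop) (by fun_prop) hx]
    refine setLIntegral_congr_fun measurableSet_Ioi fun u hu => ?_
    rw [ENNReal.ofReal_mul (hk0 u hu),
      ofReal_integral_eq_lintegral_ofReal (hfint.mono_set Ioc_subset_Ioi_self)
        ((ae_restrict_iff' measurableSet_Ioc).2 (ae_of_all _ fun z hz => hf0 z hz.1))]
  rw [setIntegral_scale_mixture_eq_toReal hf hk hf0 hk0 hρ hx, heq,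
    integral_eq_lintegral_of_nonneg_ae hae hint.aestronglyMeasurable]
  rw [heq, ← ofReal_integral_eq_lintegral_ofReal hint hae]
  exact ENNReal.ofReal_ne_top

/-- A Breiman-type limit: dominated convergence for averages of a regularly varying function. -/
theorem tendsto_integral_mul_ratio {h g b : ℝ → ℝ} {p : ℝ} (hh : Measurable h)
    (hh0 : ∀ c, 0 < c → 0 ≤ h c)
    (hgm : ∀ y, 0 < y → AEStronglyMeasurable (fun c => g (c * y)) (volume.restrict (Ioi 0)))
    (hg0 : ∀ y, 0 < y → 0 ≤ g y)
    (hgpos : ∀ᶠ y in nhdsWithin 0 (Ioi 0), 0 < g y)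
    (hratio : ∀ c, 0 < c → Tendsto (fun y => g (c * y) / g y) (nhdsWithin 0 (Ioi 0))
      (nhds (c ^ p)))
    (hb : ∀ᶠ y in nhdsWithin 0 (Ioi 0), ∀ c, 0 < c → g (c * y) ≤ b c * g y)
    (hbint : IntegrableOn (fun c => h c * b c) (Ioi 0)) :
    (∀ᶠ y in nhdsWithin 0 (Ioi 0), IntegrableOn (fun c => h c * g (c * y)) (Ioi 0)) ∧
    Tendsto (fun y => (∫ c in Ioi 0, h c * g (c * y)) / g y) (nhdsWithin 0 (Ioi 0))
      (nhds (∫ c in Ioi 0, c ^ p * h c)) := by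
  constructor
  · filter_upwards [hb, self_mem_nhdsWithin] with y hy hy0
    have hy0' : 0 < y := hy0
    refine Integrable.mono' (hbint.mul_const (g y))
      (hh.aestronglyMeasurable.mul (hgm y hy0)) ?_
    refine (ae_restrict_iff' measurableSet_Ioi).2 (ae_of_all _ fun c hc => ?_)
    have hc' : 0 < c := hc
    rw [norm_of_nonneg (mul_nonneg (hh0 c hc') (hg0 _ (mul_pos hc' hy0'))), mul_assoc]
    exact mul_le_mul_of_nonneg_left (hy c hc') (hh0 c hc')
  · have key : Tendsto (fun y => ∫ c in Ioi 0, h c * g (c * y) / g y) (nhdsWithin 0 (Ioi 0))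
        (nhds (∫ c in Ioi 0, c ^ p * h c)) := by
      refine tendsto_integral_filter_of_dominated_convergence (fun c => h c * b c) ?_ ?_ hbint ?_
      · filter_upwards [self_mem_nhdsWithin] with y hy0
        simp only [div_eq_mul_inv]
        exact (hh.aestronglyMeasurable.mul (hgm y hy0)).mul_const _
      · filter_upwards [hb, hgpos, self_mem_nhdsWithin] with y hy hgy hy0
        have hy0' : 0 < y := hy0
        refine (ae_restrict_iff' measurableSet_Ioi).2 (ae_of_all _ fun c hc => ?_)
        have hc' : 0 < c := hc
        rw [norm_of_nonneg (div_nonneg (mul_nonneg (hh0 c hc') (hg0 _ (mul_pos hc' hy0')))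
          hgy.le), div_le_iff₀ hgy, mul_assoc]
        exact mul_le_mul_of_nonneg_left (hy c hc') (hh0 c hc')
      · refine (ae_restrict_iff' measurableSet_Ioi).2 (ae_of_all _ fun c hc => ?_)
        have := (hratio c hc).const_mul (h c)
        rw [mul_comm (h c)] at this
        simpa only [mul_div_assoc] using this
    simpa only [integral_div] using key

theorem SlowlyVaryingAtTop.potter_bound {g ℓ : ℝ → ℝ} {p q : ℝ} (hℓ : SlowlyVaryingAtTop ℓ)
    (hg : Tendsto (fun x => g x / (x ^ p * ℓ (1 / x))) (nhdsWithin 0 (Ioi 0)) (nhds 1))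
    (hqp : q < p) (hmono : MonotoneOn g (Ioi 0) ∨ AntitoneOn g (Ioi 0)) :
    ∃ δ > 0, ∃ C ≥ 0, ∀ x, 0 < x → x ≤ δ → 0 < g x ∧
      ∀ v, 0 < v → v ≤ 1 → g (v * x) ≤ C * v ^ q * g x := by
  obtain ⟨δ, hδ, h⟩ := hℓ.exists_half_le hg hqp
  have hloc : ∃ K : ℝ, 0 ≤ K ∧
      ∀ x, 0 < x → x ≤ δ → ∀ v, 1 / 2 ≤ v → v ≤ 1 → g (v * x) ≤ K * g x := by
    rcases hmono with hmono | hanti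
    · refine ⟨1, zero_le_one, fun x hx _ v hv hv1 => ?_⟩
      rw [one_mul]
      exact hmono (mul_pos (by linarith) hx) hx (mul_le_of_le_one_left hx.le hv1)
    · refine ⟨(1 / 2) ^ q, by positivity, fun x hx hxδ v hv hv1 => ?_⟩
      exact (hanti (by simpa using hx) (mul_pos (by linarith) hx)
        (mul_le_mul_of_nonneg_right hv hx.le)).trans (h x hx hxδ).2
  obtain ⟨K, hK, hloc⟩ := hloc
  refine ⟨δ, hδ, K * 2 ^ |q|, by positivity, fun x hx hxδ => ⟨(h x hx hxδ).1, fun v hv hv1 => ?_⟩⟩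
  exact potter_bound_of_half hK (fun x hx hxδ => (h x hx hxδ).2) hloc
    (fun x hx hxδ => (h x hx hxδ).1.le) hx hxδ hv hv1

theorem SlowlyVaryingAtTop.potter_lower_bound {g ℓ : ℝ → ℝ} {p q : ℝ}
    (hℓ : SlowlyVaryingAtTop ℓ)
    (hg : Tendsto (fun x => g x / (x ^ p * ℓ (1 / x))) (nhdsWithin 0 (Ioi 0)) (nhds 1))
    (hpq : p < q) (hmono : MonotoneOn g (Ioi 0)) :
    ∃ δ > 0, ∃ C ≥ 0, ∀ x, 0 < x → x ≤ δ → 0 < g x ∧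
      ∀ v, 0 < v → v ≤ 1 → g x ≤ C * v ^ (-q) * g (v * x) := by
  obtain ⟨δ, hδ, h⟩ := hℓ.exists_le_half hg hpq
  have hhalf : ∀ x, 0 < x → x ≤ δ → (g (1 / 2 * x))⁻¹ ≤ (1 / 2) ^ (-q) * (g x)⁻¹ := by
    intro x hx hxδ
    obtain ⟨h1, h2⟩ := h x hx hxδ
    rw [rpow_neg (by norm_num), ← mul_inv]
    exact inv_anti₀ (by positivity) h2
  refine ⟨δ, hδ, (1 / 2) ^ (-q) * 2 ^ |-q|, by positivity,
    fun x hx hxδ => ⟨(h x hx hxδ).1, fun v hv hv1 => ?_⟩⟩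
  have hvx : v * x ≤ δ := (mul_le_of_le_one_left hx.le hv1).trans hxδ
  have key := potter_bound_of_half (g := fun x => (g x)⁻¹) (p := -q) (K := (1 / 2) ^ (-q)) (δ := δ)
    (by positivity) hhalf ?_ (fun x hx hxδ => (inv_pos.2 (h x hx hxδ).1).le) hx hxδ hv hv1
  · have g1 := (h x hx hxδ).1
    have g2 := (h _ (mul_pos hv hx) hvx).1
    rw [← div_eq_mul_inv, le_div_iff₀ g1, inv_mul_le_iff₀ g2, mul_comm (g (v * x))] at key
    exact key
  · intro x hx hxδ w hw hw1
    refine le_trans ?_ (hhalf x hx hxδ)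
    have hx2 : (0 : ℝ) < 1 / 2 * x := by positivity
    refine inv_anti₀ (h _ hx2 (by linarith)).1
      (hmono hx2 (mul_pos (by linarith) hx) (mul_le_mul_of_nonneg_right hw hx.le))

theorem SlowlyVaryingAtTop.eventually_antitone_le {g ℓ : ℝ → ℝ} {p q : ℝ}
    (hℓ : SlowlyVaryingAtTop ℓ)
    (hg : Tendsto (fun x => g x / (x ^ p * ℓ (1 / x))) (nhdsWithin 0 (Ioi 0)) (nhds 1))
    (hqp : q < p) (hanti : AntitoneOn g (Ioi 0)) :
    ∃ C : ℝ, ∀ᶠ y in nhdsWithin 0 (Ioi 0), ∀ c, 0 < c → g (c * y) ≤ (C * c ^ q + 1) * g y := by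
  obtain ⟨δ, hδ, C, hC, h⟩ := hℓ.potter_bound hg hqp (Or.inr hanti)
  refine ⟨C, ?_⟩
  filter_upwards [Ioc_mem_nhdsGT hδ] with y hy c hc
  obtain ⟨hgy, hv⟩ := h y hy.1 hy.2
  have hcq := rpow_pos_of_pos hc q
  rcases le_total c 1 with hc1 | hc1
  · have := hv c hc hc1
    linarith
  · have h1 := hanti hy.1 (mul_pos hc hy.1) (le_mul_of_one_le_left hy.1.le hc1)
    have : 0 ≤ C * c ^ q * g y := by positivity
    linarith

theorem SlowlyVaryingAtTop.eventually_monotone_le {g ℓ : ℝ → ℝ} {p q s M : ℝ}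
    (hℓ : SlowlyVaryingAtTop ℓ)
    (hg : Tendsto (fun x => g x / (x ^ p * ℓ (1 / x))) (nhdsWithin 0 (Ioi 0)) (nhds 1))
    (hqp : q < p) (hps : p < s) (hs : 0 ≤ s) (hmono : MonotoneOn g (Ioi 0))
    (hM : ∀ x, 0 < x → g x ≤ M) :
    ∃ C D : ℝ, ∀ᶠ y in nhdsWithin 0 (Ioi 0),
      ∀ c, 0 < c → g (c * y) ≤ (C * c ^ q + D * c ^ s) * g y := by
  obtain ⟨δ, hδ, C, hC, h⟩ := hℓ.potter_bound hg hqp (Or.inl hmono)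
  obtain ⟨ε, hε, B, hB, h'⟩ := hℓ.potter_lower_bound hg hps hmono
  have hgε := (h' ε hε le_rfl).1
  have hM0 : 0 < M := hgε.trans_le (hM ε hε)
  refine ⟨C, B + M * B / g ε, ?_⟩
  filter_upwards [Ioc_mem_nhdsGT hδ, Ioc_mem_nhdsGT hε] with y hy hyε c hc
  obtain ⟨hgy, hv⟩ := h y hy.1 hy.2
  have hy0 : 0 < y := hy.1
  have hcq := rpow_pos_of_pos hc q
  have hcs := rpow_pos_of_pos hc s
  have n1 : 0 ≤ C * c ^ q * g y := by positivity
  have n2 : 0 ≤ B * c ^ s * g y := by positivity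
  have n3 : 0 ≤ M * B / g ε * c ^ s * g y := by positivity
  rcases le_total c 1 with hc1 | hc1
  · have := hv c hc hc1
    linarith
  rcases le_total (c * y) ε with hcy | hcy
  · have h1 := (h' (c * y) (mul_pos hc hy0) hcy).2 c⁻¹ (inv_pos.2 hc) (inv_le_one_of_one_le₀ hc1)
    rw [inv_mul_cancel_left₀ hc.ne', inv_rpow hc.le, rpow_neg hc.le, inv_inv] at h1
    linarith
  · have h1 := (h' ε hε le_rfl).2 (y / ε) (div_pos hy0 hε) ((div_le_one hε).2 hyε.2)
    rw [div_mul_cancel₀ _ hε.ne', rpow_neg (div_pos hy0 hε).le, ← inv_rpow (div_pos hy0 hε).le,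
      inv_div] at h1
    have h2 : (ε / y) ^ s ≤ c ^ s :=
      rpow_le_rpow (div_pos hε hy0).le ((div_le_iff₀ hy0).2 hcy) hs
    have h3 : g ε ≤ B * c ^ s * g y :=
      h1.trans (mul_le_mul_of_nonneg_right (mul_le_mul_of_nonneg_left h2 hB) hgy.le)
    have h4 : M ≤ M * B / g ε * c ^ s * g y := by
      have : M * B / g ε * c ^ s * g y = M * (B * c ^ s * g y) / g ε := by ring
      rw [this, le_div_iff₀ hgε]
      exact mul_le_mul_of_nonneg_left h3 hM0.le
    have := hM (c * y) (mul_pos hc hy0)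
    linarith

theorem integrableOn_rpow_mul_Ioi_of_le {h : ℝ → ℝ} {a r s : ℝ} (ha : 0 < a) (hh : Measurable h)
    (hrs : r ≤ s) (hint : IntegrableOn (fun z => z ^ s * h z) (Ioi a)) :
    IntegrableOn (fun z => z ^ r * h z) (Ioi a) := by
  refine Integrable.mono' (hint.norm.const_mul (a ^ (r - s)))
    ((measurable_id.pow_const r).mul hh).aestronglyMeasurable ?_
  refine (ae_restrict_iff' measurableSet_Ioi).2 (ae_of_all _ fun z hz => ?_)
  have hz0 : 0 < z := ha.trans hz
  have h1 : z ^ r ≤ a ^ (r - s) * z ^ s := by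
    calc z ^ r = z ^ (r - s) * z ^ s := by rw [← rpow_add hz0]; ring_nf
      _ ≤ a ^ (r - s) * z ^ s := mul_le_mul_of_nonneg_right
        (rpow_le_rpow_of_nonpos ha (le_of_lt hz) (by linarith)) (rpow_nonneg hz0.le s)
  rw [norm_mul, norm_mul, norm_of_nonneg (rpow_nonneg hz0.le r),
    norm_of_nonneg (rpow_nonneg hz0.le s), ← mul_assoc]
  exact mul_le_mul_of_nonneg_right h1 (norm_nonneg _)

theorem integrableOn_rpow_mul_Ioi_zero {h : ℝ → ℝ} {δ r s : ℝ} (hδ : 0 < δ) (hh : Measurable h)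
    (hrs : r ≤ s) (h0 : IntegrableOn (fun z => z ^ r * h z) (Ioc 0 δ))
    (hint : IntegrableOn (fun z => z ^ s * h z) (Ioi δ)) :
    IntegrableOn (fun z => z ^ r * h z) (Ioi 0) := by
  rw [← Ioc_union_Ioi_eq_Ioi hδ.le]
  exact h0.union (integrableOn_rpow_mul_Ioi_of_le hδ hh hrs hint)

theorem setIntegral_rpow_mul_pos {h : ℝ → ℝ} {p : ℝ} {s : Set ℝ} (hs : MeasurableSet s)
    (hs0 : s ⊆ Ioi 0) (hh : ∀ z, 0 < z → 0 ≤ h z)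
    (hint : IntegrableOn (fun z => z ^ p * h z) (Ioi 0)) (hpos : 0 < ∫ z in s, h z) :
    0 < ∫ z in Ioi (0 : ℝ), z ^ p * h z := by
  have hnn : ∀ z ∈ Ioi (0 : ℝ), 0 ≤ z ^ p * h z := fun z hz =>
    mul_nonneg (rpow_nonneg (le_of_lt hz) p) (hh z hz)
  refine (setIntegral_nonneg measurableSet_Ioi hnn).lt_of_ne fun h0 => hpos.ne' ?_
  have hae := (setIntegral_eq_zero_iff_of_nonneg_ae
    ((ae_restrict_iff' measurableSet_Ioi).2 (ae_of_all _ hnn)) hint).1 h0.symm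
  rw [Filter.EventuallyEq, ae_restrict_iff' measurableSet_Ioi] at hae
  refine integral_eq_zero_of_ae ((ae_restrict_iff' hs).2 ?_)
  filter_upwards [hae] with z hz hzs
  have hz0 : 0 < z := hs0 hzs
  exact (mul_eq_zero.1 (hz hz0)).resolve_left (rpow_pos_of_pos hz0 p).ne'

theorem SlowlyVaryingAtTop.tendsto_div_const_mul {I g ℓ : ℝ → ℝ} {p E : ℝ}
    (hℓ : SlowlyVaryingAtTop ℓ)
    (hg : Tendsto (fun x => g x / (x ^ p * ℓ (1 / x))) (nhdsWithin 0 (Ioi 0)) (nhds 1))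
    (hE : 0 < E) (hI : Tendsto (fun x => I x / g x) (nhdsWithin 0 (Ioi 0)) (nhds E)) :
    Tendsto (fun x => I x / (E * x ^ p * ℓ (1 / x))) (nhdsWithin 0 (Ioi 0)) (nhds 1) := by
  have h := (hI.mul hg).div_const E
  rw [mul_one, div_self hE.ne'] at h
  refine h.congr' ?_
  filter_upwards [hℓ.eventually_pos_of_tendsto hg] with x hx
  rw [div_mul_div_cancel₀ hx.ne', div_div, mul_comm _ E, mul_assoc]

/-- **Scaled CRMs are doubly regularly varying.** Let `0 < α < 1 < ∞`, `τ > α`, let `ρ₀` be a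
Lévy density whose tail `ρ̄₀(x) = ∫_x^∞ ρ₀` satisfies `ρ̄₀(x) ~ x^{−α} ℓ₁(1/x)` as `x → 0⁺`,
and let `f_Z` be a locally bounded probability density on `(0,∞)` whose cdf satisfies
`F_Z(z) ~ z^τ ℓ₂(1/z)` as `z → 0⁺`. Set `ρ(w) = ∫_0^∞ z f_Z(z) ρ₀(wz) dz`. If `x ρ(x)` and
`f_Z(x)` are ultimately bounded and `μ_β = ∫_0^∞ w^β ρ₀(w) dw < ∞` for some `β > τ`, then the
tail `ρ̄(x) = ∫_x^∞ ρ` satisfies `ρ̄(x) ~ E(Z^{−α}) x^{−α} ℓ₁(1/x)` as `x → 0⁺` and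
`ρ̄(x) ~ μ_τ x^{−τ} ℓ₂(x)` as `x → ∞`. -/
theorem scaled_crm_doubly_regularly_varying
    (α τ : ℝ) (hα0 : 0 < α) (hα1 : α < 1) (hατ : α < τ)
    (ρ₀ : ℝ → ℝ) (hρ₀meas : Measurable ρ₀) (hρ₀nonneg : ∀ w : ℝ, 0 < w → 0 ≤ ρ₀ w)
    (hρ₀locbdd : LocallyBoundedOnPos ρ₀)
    (ℓ₁ ℓ₂ : ℝ → ℝ) (hℓ₁ : SlowlyVaryingAtTop ℓ₁) (hℓ₂ : SlowlyVaryingAtTop ℓ₂)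
    (hρ₀asymp : Tendsto
      (fun x => (∫ w in Set.Ioi x, ρ₀ w) / (x ^ (-α) * ℓ₁ (1 / x)))
      (nhdsWithin 0 (Set.Ioi 0)) (nhds 1))
    (fZ : ℝ → ℝ) (hfZmeas : Measurable fZ) (hfZnonneg : ∀ z : ℝ, 0 < z → 0 ≤ fZ z)
    (hfZlocbdd : LocallyBoundedOnPos fZ)
    (hfZint : IntegrableOn fZ (Set.Ioi 0))
    (hfZprob : ∫ z in Set.Ioi (0:ℝ), fZ z = 1)
    (hFZasymp : Tendsto
      (fun z => (∫ s in Set.Ioc (0:ℝ) z, fZ s) / (z ^ τ * ℓ₂ (1 / z)))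
      (nhdsWithin 0 (Set.Ioi 0)) (nhds 1))
    (ρ : ℝ → ℝ)
    (hρdef : ∀ w : ℝ, 0 < w → ρ w = ∫ z in Set.Ioi (0:ℝ), z * fZ z * ρ₀ (w * z))
    (hρbdd : ∃ x₀ M : ℝ, ∀ x : ℝ, x₀ ≤ x → |x * ρ x| ≤ M)
    (hfZbdd : ∃ x₀ M : ℝ, ∀ x : ℝ, x₀ ≤ x → |fZ x| ≤ M)
    (β : ℝ) (hβ : τ < β)
    (hμβ : IntegrableOn (fun w => w ^ β * ρ₀ w) (Set.Ioi 0)) :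
    Tendsto
      (fun x => (∫ w in Set.Ioi x, ρ w) /
        ((∫ z in Set.Ioi (0:ℝ), z ^ (-α) * fZ z) * x ^ (-α) * ℓ₁ (1 / x)))
      (nhdsWithin 0 (Set.Ioi 0)) (nhds 1) ∧
    Tendsto
      (fun x => (∫ w in Set.Ioi x, ρ w) /
        ((∫ w in Set.Ioi (0:ℝ), w ^ τ * ρ₀ w) * x ^ (-τ) * ℓ₂ x))
      atTop (nhds 1) := by
  set R : ℝ → ℝ := fun x => ∫ w in Ioi x, ρ₀ w with hR
  set F : ℝ → ℝ := fun z => ∫ s in Ioc (0 : ℝ) z, fZ s with hF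
  obtain ⟨γ, hγα, hγτ⟩ := exists_between hατ
  obtain ⟨κ, hγκ, hκτ⟩ := exists_between hγτ
  have hβ0 : 0 ≤ β := by linarith
  have hρ₀int : ∀ x, 0 < x → IntegrableOn ρ₀ (Ioi x) := fun x hx => by
    simpa using integrableOn_rpow_mul_Ioi_of_le hx hρ₀meas hβ0
      (hμβ.mono_set (Ioi_subset_Ioi hx.le))
  have hFint : ∀ z, IntegrableOn fZ (Ioc 0 z) := fun z => hfZint.mono_set Ioc_subset_Ioi_self
  have hRnonneg : ∀ x, 0 < x → 0 ≤ R x := fun x hx =>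
    setIntegral_nonneg measurableSet_Ioi fun u hu => hρ₀nonneg u (hx.trans hu)
  have hFnonneg : ∀ x, 0 < x → 0 ≤ F x := fun x _ =>
    setIntegral_nonneg measurableSet_Ioc fun u hu => hfZnonneg u hu.1
  have hRanti : AntitoneOn R (Ioi 0) := fun x hx y _ hxy =>
    setIntegral_mono_set (hρ₀int x hx)
      ((ae_restrict_iff' measurableSet_Ioi).2 (ae_of_all _ fun u hu =>
        hρ₀nonneg u (lt_trans hx hu))) (Ioi_subset_Ioi hxy).eventuallyLE
  have hFmono : MonotoneOn F (Ioi 0) := fun x _ y _ hxy =>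
    setIntegral_mono_set (hFint y)
      ((ae_restrict_iff' measurableSet_Ioc).2 (ae_of_all _ fun u hu => hfZnonneg u hu.1))
      (Ioc_subset_Ioc_right hxy).eventuallyLE
  have hFle : ∀ x, 0 < x → F x ≤ 1 := fun x _ => hfZprob ▸
    setIntegral_mono_set hfZint
      ((ae_restrict_iff' measurableSet_Ioi).2 (ae_of_all _ fun u hu => hfZnonneg u hu))
      Ioc_subset_Ioi_self.eventuallyLE
  have hfZmoment : ∀ r, 0 < κ + r → r ≤ 0 → IntegrableOn (fun z => z ^ r * fZ z) (Ioi 0) := by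
    intro r hr hr0
    obtain ⟨δ, hδ, C, hC, h⟩ := hℓ₂.potter_bound hFZasymp hκτ (Or.inl hFmono)
    refine integrableOn_rpow_mul_Ioi_zero hδ hfZmeas hr0 ?_
      (by simpa using hfZint.mono_set (Ioi_subset_Ioi hδ.le))
    refine integrableOn_rpow_mul_Ioc_of_dyadic (C := C * F δ) (q := κ) hδ hfZnonneg
      (fun a ha => (hFint δ).mono_set (Ioc_subset_Ioc_left ha.le)) (fun n => ?_) hr
    have h1 := (h δ hδ le_rfl).2 ((1 / 2) ^ n) (by positivity)
      (pow_le_one₀ (by norm_num) (by norm_num))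
    rw [mul_right_comm]
    exact (setIntegral_mono_set (hFint _)
      ((ae_restrict_iff' measurableSet_Ioc).2 (ae_of_all _ fun u hu => hfZnonneg u hu.1))
      (Ioc_subset_Ioc_left (by positivity)).eventuallyLE).trans h1
  have hρ₀moment : ∀ r, γ < r → r ≤ β → IntegrableOn (fun w => w ^ r * ρ₀ w) (Ioi 0) := by
    intro r hr hrβ
    obtain ⟨δ, hδ, C, hC, h⟩ := hℓ₁.potter_bound hρ₀asymp (neg_lt_neg hγα) (Or.inr hRanti)
    refine integrableOn_rpow_mul_Ioi_zero hδ hρ₀meas hrβ ?_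
      (hμβ.mono_set (Ioi_subset_Ioi hδ.le))
    refine integrableOn_rpow_mul_Ioc_of_dyadic (C := C * (1 / 2) ^ (-γ) * R δ) (q := -γ) hδ
      hρ₀nonneg (fun a ha => (hρ₀int a ha).mono_set Ioc_subset_Ioi_self) (fun n => ?_)
      (by linarith)
    have hpos : (0 : ℝ) < (1 / 2) ^ (n + 1) * δ := by positivity
    have h1 := (h δ hδ le_rfl).2 ((1 / 2) ^ (n + 1)) (by positivity)
      (pow_le_one₀ (by norm_num) (by norm_num))
    have h2 : ((1 / 2 : ℝ) ^ (n + 1)) ^ (-γ) = (1 / 2) ^ (-γ) * ((1 / 2) ^ n) ^ (-γ) := by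
      rw [pow_succ', mul_rpow (by norm_num) (by positivity)]
    rw [h2] at h1
    have h3 : ∫ z in Ioc ((1 / 2) ^ (n + 1) * δ) ((1 / 2) ^ n * δ), ρ₀ z ≤
        R ((1 / 2) ^ (n + 1) * δ) :=
      setIntegral_mono_set (hρ₀int _ hpos)
        ((ae_restrict_iff' measurableSet_Ioi).2 (ae_of_all _ fun u hu =>
          hρ₀nonneg u (hpos.trans hu))) Ioc_subset_Ioi_self.eventuallyLE
    linarith
  constructor
  · obtain ⟨C, hC⟩ := hℓ₁.eventually_antitone_le hρ₀asymp (neg_lt_neg hγα) hRanti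
    have hbint : IntegrableOn (fun c => fZ c * (C * c ^ (-γ) + 1)) (Ioi 0) := by
      refine (((hfZmoment (-γ) (by linarith) (by linarith)).const_mul C).add hfZint).congr
        (ae_of_all _ fun c => ?_)
      simp only [Pi.add_apply]
      ring
    have hm : ∀ y, 0 < y →
        AEStronglyMeasurable (fun c => R (c * y)) (volume.restrict (Ioi 0)) := fun y hy =>
      (aemeasurable_restrict_of_antitoneOn measurableSet_Ioi fun a ha b hb hab =>
        hRanti (mul_pos ha hy) (mul_pos hb hy)
          (mul_le_mul_of_nonneg_right hab hy.le)).aestronglyMeasurable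
    obtain ⟨hev, hlim⟩ := tendsto_integral_mul_ratio (g := R) hfZmeas hfZnonneg hm hRnonneg
      (hℓ₁.eventually_pos_of_tendsto hρ₀asymp) (fun c hc => hℓ₁.tendsto_ratio hρ₀asymp hc)
      hC hbint
    refine hℓ₁.tendsto_div_const_mul hρ₀asymp ?_ (hlim.congr' ?_)
    · exact setIntegral_rpow_mul_pos measurableSet_Ioi subset_rfl hfZnonneg
        (hfZmoment (-α) (by linarith) (by linarith)) (hfZprob ▸ zero_lt_one)
    · filter_upwards [hev, self_mem_nhdsWithin] with y hy hy0
      rw [setIntegral_scale_mixture_eq_tail hfZmeas hρ₀meas hfZnonneg hρ₀nonneg hρ₀int hρdef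
        hy0 hy]
  · obtain ⟨C, D, hCD⟩ := hℓ₂.eventually_monotone_le hFZasymp hκτ hβ hβ0 hFmono hFle
    have hbint : IntegrableOn (fun c => ρ₀ c * (C * c ^ κ + D * c ^ β)) (Ioi 0) := by
      refine (((hρ₀moment κ hγκ (by linarith)).const_mul C).add (hμβ.const_mul D)).congr
        (ae_of_all _ fun c => ?_)
      simp only [Pi.add_apply]
      ring
    have hm : ∀ y, 0 < y →
        AEStronglyMeasurable (fun c => F (c * y)) (volume.restrict (Ioi 0)) := fun y hy =>
      (aemeasurable_restrict_of_monotoneOn measurableSet_Ioi fun a ha b hb hab =>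
        hFmono (mul_pos ha hy) (mul_pos hb hy)
          (mul_le_mul_of_nonneg_right hab hy.le)).aestronglyMeasurable
    obtain ⟨hev, hlim⟩ := tendsto_integral_mul_ratio (g := F) hρ₀meas hρ₀nonneg hm hFnonneg
      (hℓ₂.eventually_pos_of_tendsto hFZasymp) (fun c hc => hℓ₂.tendsto_ratio hFZasymp hc)
      hCD hbint
    have hpos : 0 < ∫ w in Ioi (0 : ℝ), w ^ τ * ρ₀ w := by
      obtain ⟨x, hx, hx0⟩ := ((hℓ₁.eventually_pos_of_tendsto hρ₀asymp).and
        self_mem_nhdsWithin).exists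
      exact setIntegral_rpow_mul_pos measurableSet_Ioi (Ioi_subset_Ioi (le_of_lt hx0)) hρ₀nonneg
        (hρ₀moment τ hγτ hβ.le) hx
    have hkey := (hℓ₂.tendsto_div_const_mul hFZasymp hpos hlim).comp tendsto_inv_atTop_nhdsGT_zero
    refine hkey.congr' ?_
    filter_upwards [tendsto_inv_atTop_nhdsGT_zero.eventually hev, eventually_gt_atTop 0]
      with x hx hx0
    rw [setIntegral_scale_mixture_eq_cdf hfZmeas hρ₀meas hfZnonneg hρ₀nonneg hfZint hρdef hx0 hx]
    simp only [Function.comp_apply, one_div, inv_inv, inv_rpow hx0.le, rpow_neg hx0.le, hF]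
end

section
/- Let σ < 1, τ > max(0,σ) and c > 0, and let ρ(w) = w^{−1−τ} γ(τ−σ, cw)/Γ(1−σ) for w > 0. Then the tail Lévy intensity ρ̄(x) = ∫_x^∞ ρ(w) dw is finite for every x > 0 and satisfies ρ̄(x)/( (Γ(τ−σ)/(τ Γ(1−σ))) x^{−τ} ) → 1 as x → ∞. -/
open MeasureTheory Real Filter Set

/-- The lower incomplete gamma function `γ(s,x) = ∫_0^x u^{s−1} e^{−u} du`. -/
noncomputable def lowerIncGamma (s x : ℝ) : ℝ :=
  ∫ u in (0:ℝ)..x, u ^ (s - 1) * Real.exp (-u)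

theorem integrableOn_gammaIntegrand_Ioc {s : ℝ} (hs : 0 < s) (x : ℝ) :
    IntegrableOn (fun u : ℝ => u ^ (s - 1) * Real.exp (-u)) (Ioc 0 x) :=
  ((Real.GammaIntegral_convergent hs).congr_fun (fun _ _ => mul_comm _ _)
    measurableSet_Ioi).mono_set Ioc_subset_Ioi_self

theorem monotoneOn_lowerIncGamma {s : ℝ} (hs : 0 < s) :
    MonotoneOn (lowerIncGamma s) (Ici 0) := by
  intro x hx y hy hxy
  simp only [lowerIncGamma, intervalIntegral.integral_of_le (mem_Ici.1 hx),
    intervalIntegral.integral_of_le (mem_Ici.1 hy)]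
  refine setIntegral_mono_set (integrableOn_gammaIntegrand_Ioc hs y) ?_
    (Ioc_subset_Ioc_right hxy).eventuallyLE
  filter_upwards [ae_restrict_mem measurableSet_Ioc] with u hu
  exact mul_nonneg (rpow_nonneg hu.1.le _) (Real.exp_pos _).le

theorem lowerIncGamma_nonneg {s x : ℝ} (hs : 0 < s) (hx : 0 ≤ x) : 0 ≤ lowerIncGamma s x := by
  simpa [lowerIncGamma] using monotoneOn_lowerIncGamma hs self_mem_Ici (mem_Ici.2 hx) hx

theorem tendsto_lowerIncGamma_atTop {s : ℝ} (hs : 0 < s) :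
    Tendsto (lowerIncGamma s) atTop (nhds (Real.Gamma s)) := by
  simp only [Real.Gamma_eq_integral hs, mul_comm (Real.exp _)]
  exact intervalIntegral_tendsto_integral_Ioi 0
    ((Real.GammaIntegral_convergent hs).congr_fun (fun _ _ => mul_comm _ _) measurableSet_Ioi)
    tendsto_id

theorem lowerIncGamma_le_Gamma {s x : ℝ} (hs : 0 < s) (hx : 0 ≤ x) :
    lowerIncGamma s x ≤ Real.Gamma s :=
  ge_of_tendsto (tendsto_lowerIncGamma_atTop hs) <| (eventually_ge_atTop x).mono fun _ hy =>
    monotoneOn_lowerIncGamma hs (mem_Ici.2 hx) (mem_Ici.2 (hx.trans hy)) hy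

theorem integral_Ioi_rpow_neg_one_sub {τ x : ℝ} (hτ : 0 < τ) (hx : 0 < x) :
    ∫ w in Ioi x, w ^ (-1 - τ) = x ^ (-τ) / τ := by
  rw [integral_Ioi_rpow_of_lt (by linarith) hx, show -1 - τ + 1 = -τ by ring, neg_div_neg_eq]

theorem integrableOn_rpow_mul_of_monotoneOn {g : ℝ → ℝ} {L τ x : ℝ} (hτ : 0 < τ) (hx : 0 < x)
    (hg : MonotoneOn g (Ioi 0)) (hg0 : ∀ w, 0 < w → 0 ≤ g w) (hgL : ∀ w, 0 < w → g w ≤ L) :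
    IntegrableOn (fun w => w ^ (-1 - τ) * g w) (Ioi x) := by
  have hm : AEStronglyMeasurable g (volume.restrict (Ioi x)) :=
    (aemeasurable_restrict_of_monotoneOn measurableSet_Ioi
      (hg.mono (Ioi_subset_Ioi hx.le))).aestronglyMeasurable
  refine (integrableOn_Ioi_rpow_of_lt (by linarith) hx).mul_bdd (c := L) hm ?_
  filter_upwards [ae_restrict_mem measurableSet_Ioi] with w hw
  have hw0 : 0 < w := hx.trans hw
  rw [Real.norm_of_nonneg (hg0 w hw0)]
  exact hgL w hw0

/-- If `g` increases to `L > 0`, then `∫_x^∞ w^{-1-τ} g(w) dw ~ (L / τ) x^{-τ}` as `x → ∞`. -/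
theorem tendsto_integral_rpow_mul_of_monotoneOn {g : ℝ → ℝ} {L τ : ℝ} (hτ : 0 < τ) (hL : 0 < L)
    (hg : MonotoneOn g (Ioi 0)) (hg0 : ∀ w, 0 < w → 0 ≤ g w) (hgL : ∀ w, 0 < w → g w ≤ L)
    (hlim : Tendsto g atTop (nhds L)) :
    Tendsto (fun x : ℝ => (∫ w in Ioi x, w ^ (-1 - τ) * g w) / (L / τ * x ^ (-τ)))
      atTop (nhds 1) := by
  have hlim' : Tendsto (fun x => g x / L) atTop (nhds 1) := by
    simpa [hL.ne'] using hlim.div_const L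
  refine tendsto_of_tendsto_of_tendsto_of_le_of_le' hlim' tendsto_const_nhds ?_ ?_
  all_goals
    filter_upwards [eventually_gt_atTop 0] with x hx
    have hint := integrableOn_rpow_mul_of_monotoneOn hτ hx hg hg0 hgL
    have hpow : IntegrableOn (fun w : ℝ => w ^ (-1 - τ)) (Ioi x) :=
      integrableOn_Ioi_rpow_of_lt (by linarith) hx
    have hxτ : 0 < x ^ (-τ) := rpow_pos_of_pos hx _
  · rw [le_div_iff₀ (by positivity)]
    calc g x / L * (L / τ * x ^ (-τ)) = ∫ w in Ioi x, w ^ (-1 - τ) * g x := by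
          rw [integral_mul_const, integral_Ioi_rpow_neg_one_sub hτ hx]
          field_simp
      _ ≤ ∫ w in Ioi x, w ^ (-1 - τ) * g w :=
          setIntegral_mono_on (hpow.mul_const _) hint measurableSet_Ioi fun w hw =>
            mul_le_mul_of_nonneg_left (hg hx (hx.trans hw) (le_of_lt hw))
              (rpow_nonneg (hx.trans hw).le _)
  · rw [div_le_one (by positivity)]
    calc ∫ w in Ioi x, w ^ (-1 - τ) * g w ≤ ∫ w in Ioi x, w ^ (-1 - τ) * L :=
          setIntegral_mono_on hint (hpow.mul_const _) measurableSet_Ioi fun w hw =>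
            mul_le_mul_of_nonneg_left (hgL w (hx.trans hw)) (rpow_nonneg (hx.trans hw).le _)
      _ = L / τ * x ^ (-τ) := by
          rw [integral_mul_const, integral_Ioi_rpow_neg_one_sub hτ hx]
          ring

/-- **Tail of the generalized BFRY Lévy intensity at infinity.** For `σ < 1`,
`τ > max(0,σ)`, `c > 0` and `ρ(w) = w^{−1−τ} γ(τ−σ, cw)/Γ(1−σ)`, the tail
`ρ̄(x) = ∫_x^∞ ρ(w) dw` is finite for every `x > 0` and
`ρ̄(x) ~ (Γ(τ−σ)/(τ Γ(1−σ))) x^{−τ}` as `x → ∞`. -/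
theorem gbfry_tail_levy_intensity_atTop
    (σ τ c : ℝ) (hσ : σ < 1) (hτ : max 0 σ < τ) (hc : 0 < c) :
    (∀ x : ℝ, 0 < x → IntegrableOn
      (fun w => w ^ (-1 - τ) * lowerIncGamma (τ - σ) (c * w) / Real.Gamma (1 - σ))
      (Set.Ioi x)) ∧
    Tendsto
      (fun x : ℝ =>
        (∫ w in Set.Ioi x, w ^ (-1 - τ) * lowerIncGamma (τ - σ) (c * w) / Real.Gamma (1 - σ)) /
          (Real.Gamma (τ - σ) / (τ * Real.Gamma (1 - σ)) * x ^ (-τ)))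
      atTop (nhds 1) := by
  obtain ⟨hτ0, hστ⟩ := max_lt_iff.1 hτ
  have hs : 0 < τ - σ := sub_pos.2 hστ
  have hΓ : 0 < Real.Gamma (1 - σ) := Real.Gamma_pos_of_pos (sub_pos.2 hσ)
  have hmono : MonotoneOn (fun w => lowerIncGamma (τ - σ) (c * w)) (Ioi 0) :=
    fun x hx y hy hxy => monotoneOn_lowerIncGamma hs (mul_pos hc hx).le (mul_pos hc hy).le
      (mul_le_mul_of_nonneg_left hxy hc.le)
  have hnonneg : ∀ w, 0 < w → 0 ≤ lowerIncGamma (τ - σ) (c * w) :=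
    fun w hw => lowerIncGamma_nonneg hs (mul_pos hc hw).le
  have hle : ∀ w, 0 < w → lowerIncGamma (τ - σ) (c * w) ≤ Real.Gamma (τ - σ) :=
    fun w hw => lowerIncGamma_le_Gamma hs (mul_pos hc hw).le
  refine ⟨fun x hx =>
    (integrableOn_rpow_mul_of_monotoneOn hτ0 hx hmono hnonneg hle).div_const _, ?_⟩
  refine (tendsto_integral_rpow_mul_of_monotoneOn hτ0 (Real.Gamma_pos_of_pos hs) hmono hnonneg
    hle ((tendsto_lowerIncGamma_atTop hs).comp (tendsto_id.const_mul_atTop hc))).congr fun x => ?_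
  rw [integral_div, ← div_div (Real.Gamma (τ - σ)), div_mul_eq_mul_div _ (Real.Gamma (1 - σ)),
    div_div_div_cancel_right₀ hΓ.ne']
end

section
/- Let 0 < σ < 1, τ > σ and c > 0, and let ρ(w) = w^{−1−τ} γ(τ−σ, cw)/Γ(1−σ) for w > 0. Then the tail Lévy intensity ρ̄(x) = ∫_x^∞ ρ(w) dw satisfies ρ̄(x)/( (c^{τ−σ}/(σ(τ−σ)Γ(1−σ))) x^{−σ} ) → 1 as x → 0⁺. -/
open MeasureTheory Real Filter Set

lemma intervalIntegrable_rpow_mul_exp_neg {s : ℝ} (hs : 0 < s) (a b : ℝ) :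
    IntervalIntegrable (fun u : ℝ => u ^ (s - 1) * Real.exp (-u)) volume a b :=
  (intervalIntegral.intervalIntegrable_rpow' (by linarith)).mul_continuousOn
    (by fun_prop)

lemma continuous_lowerIncGamma {s : ℝ} (hs : 0 < s) : Continuous (lowerIncGamma s) :=
  intervalIntegral.continuous_primitive (intervalIntegrable_rpow_mul_exp_neg hs) 0

lemma integral_rpow_sub_one {s : ℝ} (hs : 0 < s) (y : ℝ) :
    ∫ u in (0:ℝ)..y, u ^ (s - 1) = y ^ s / s := by
  rw [integral_rpow (Or.inl (by linarith))]
  simp [hs.ne']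

lemma lowerIncGamma_le {s y : ℝ} (hs : 0 < s) (hy : 0 ≤ y) :
    lowerIncGamma s y ≤ y ^ s / s := by
  rw [← integral_rpow_sub_one hs, lowerIncGamma]
  refine intervalIntegral.integral_mono_on hy (intervalIntegrable_rpow_mul_exp_neg hs 0 y)
    (intervalIntegral.intervalIntegrable_rpow' (by linarith)) fun u hu => ?_
  exact mul_le_of_le_one_right (rpow_nonneg hu.1 _) (Real.exp_le_one_iff.2 (by linarith [hu.1]))

lemma le_lowerIncGamma {s y : ℝ} (hs : 0 < s) (hy : 0 ≤ y) :
    y ^ s / s * Real.exp (-y) ≤ lowerIncGamma s y := by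
  rw [← integral_rpow_sub_one hs, lowerIncGamma, ← intervalIntegral.integral_mul_const]
  refine intervalIntegral.integral_mono_on hy
    ((intervalIntegral.intervalIntegrable_rpow' (by linarith)).mul_const _)
    (intervalIntegrable_rpow_mul_exp_neg hs 0 y) fun u hu => ?_
  exact mul_le_mul_of_nonneg_left (Real.exp_le_exp.2 (by linarith [hu.2])) (rpow_nonneg hu.1 _)

lemma lowerIncGamma_mul_rpow_neg_le {s y : ℝ} (hs : 0 < s) (hy : 0 < y) :
    lowerIncGamma s y * y ^ (-s) ≤ 1 / s := by
  rw [rpow_neg hy.le, ← div_eq_mul_inv, div_le_iff₀ (rpow_pos_of_pos hy s), one_div_mul_eq_div]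
  exact lowerIncGamma_le hs hy.le

lemma le_lowerIncGamma_mul_rpow_neg {s y : ℝ} (hs : 0 < s) (hy : 0 < y) :
    1 / s * Real.exp (-y) ≤ lowerIncGamma s y * y ^ (-s) := by
  rw [rpow_neg hy.le, ← div_eq_mul_inv, le_div_iff₀ (rpow_pos_of_pos hy s)]
  calc 1 / s * Real.exp (-y) * y ^ s = y ^ s / s * Real.exp (-y) := by ring
    _ ≤ _ := le_lowerIncGamma hs hy.le

lemma tendsto_lowerIncGamma_mul_rpow_neg {s : ℝ} (hs : 0 < s) :
    Tendsto (fun y => lowerIncGamma s y * y ^ (-s)) (nhdsWithin 0 (Ioi 0)) (nhds (1 / s)) := by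
  have hlow : Tendsto (fun y : ℝ => 1 / s * Real.exp (-y)) (nhdsWithin 0 (Ioi 0))
      (nhds (1 / s)) := by
    have hcont : Continuous fun y : ℝ => 1 / s * Real.exp (-y) := by fun_prop
    simpa using (hcont.tendsto 0).mono_left nhdsWithin_le_nhds
  refine tendsto_of_tendsto_of_tendsto_of_le_of_le' hlow tendsto_const_nhds ?_ ?_
  · filter_upwards [self_mem_nhdsWithin] with y hy using le_lowerIncGamma_mul_rpow_neg hs hy
  · filter_upwards [self_mem_nhdsWithin] with y hy using lowerIncGamma_mul_rpow_neg_le hs hy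

lemma tendsto_integral_rescaled_lowerIncGamma {σ s c : ℝ} (hσ : 0 < σ) (hs : 0 < s)
    (hc : 0 < c) :
    Tendsto (fun x : ℝ => ∫ t in Ioi (1:ℝ),
        t ^ (-1 - σ) * (lowerIncGamma s (c * (x * t)) * (c * (x * t)) ^ (-s)))
      (nhdsWithin 0 (Ioi 0)) (nhds (1 / (σ * s))) := by
  have hint : IntegrableOn (fun t : ℝ => t ^ (-1 - σ)) (Ioi 1) :=
    integrableOn_Ioi_rpow_of_lt (by linarith) one_pos
  have hval : ∫ t in Ioi (1:ℝ), t ^ (-1 - σ) * (1 / s) = 1 / (σ * s) := by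
    rw [integral_mul_const, integral_Ioi_rpow_of_lt (by linarith) one_pos, one_rpow,
      show -1 - σ + 1 = -σ by ring]
    field_simp
  rw [← hval]
  refine tendsto_integral_filter_of_dominated_convergence (fun t => t ^ (-1 - σ) * (1 / s))
    ?_ ?_ (hint.mul_const _) ?_
  · refine Eventually.of_forall fun x => Measurable.aestronglyMeasurable ?_
    have := (continuous_lowerIncGamma hs).measurable
    fun_prop
  · filter_upwards [self_mem_nhdsWithin] with x hx
    filter_upwards [ae_restrict_mem measurableSet_Ioi] with t ht
    have ht0 : 0 < t := one_pos.trans ht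
    have hy : 0 < c * (x * t) := mul_pos hc (mul_pos hx ht0)
    have hnn : 0 ≤ lowerIncGamma s (c * (x * t)) * (c * (x * t)) ^ (-s) :=
      le_trans (by positivity) (le_lowerIncGamma_mul_rpow_neg hs hy)
    rw [Real.norm_of_nonneg (mul_nonneg (rpow_nonneg ht0.le _) hnn)]
    exact mul_le_mul_of_nonneg_left (lowerIncGamma_mul_rpow_neg_le hs hy) (rpow_nonneg ht0.le _)
  · filter_upwards [ae_restrict_mem measurableSet_Ioi] with t ht
    have ht0 : 0 < t := one_pos.trans ht
    refine ((tendsto_lowerIncGamma_mul_rpow_neg hs).comp ?_).const_mul _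
    refine tendsto_nhdsWithin_iff.2 ⟨?_, ?_⟩
    · have hcont : Continuous fun x : ℝ => c * (x * t) := by fun_prop
      simpa using (hcont.tendsto 0).mono_left nhdsWithin_le_nhds
    · filter_upwards [self_mem_nhdsWithin] with x hx using mul_pos hc (mul_pos hx ht0)

lemma integral_gbfry_tail_eq {σ τ c x : ℝ} (hc : 0 < c) (hx : 0 < x) (Γ₀ : ℝ) :
    ∫ w in Ioi x, w ^ (-1 - τ) * lowerIncGamma (τ - σ) (c * w) / Γ₀ =
      c ^ (τ - σ) * x ^ (-σ) / Γ₀ * ∫ t in Ioi (1:ℝ), t ^ (-1 - σ) *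
        (lowerIncGamma (τ - σ) (c * (x * t)) * (c * (x * t)) ^ (-(τ - σ))) := by
  have hsub := integral_comp_mul_left_Ioi
    (fun w : ℝ => w ^ (-1 - τ) * lowerIncGamma (τ - σ) (c * w) / Γ₀) 1 hx
  rw [mul_one, smul_eq_mul, eq_inv_mul_iff_mul_eq₀ hx.ne'] at hsub
  rw [← hsub, ← integral_const_mul, ← integral_const_mul]
  refine setIntegral_congr_fun measurableSet_Ioi fun t ht => ?_
  have ht0 : 0 < t := one_pos.trans ht
  have hcs : c ^ (τ - σ) * c ^ (-(τ - σ)) = 1 := by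
    rw [← rpow_add hc]; simp
  have hxs : x * x ^ (-1 - τ) = x ^ (-σ) * x ^ (-(τ - σ)) := by
    rw [← rpow_add hx]
    nth_rw 1 [← rpow_one x]
    rw [← rpow_add hx]
    ring_nf
  have hts : t ^ (-1 - τ) = t ^ (-1 - σ) * t ^ (-(τ - σ)) := by
    rw [← rpow_add ht0]; ring_nf
  rw [mul_rpow hc.le (mul_pos hx ht0).le, mul_rpow hx.le ht0.le, mul_rpow hx.le ht0.le, hts]
  linear_combination (lowerIncGamma (τ - σ) (c * (x * t)) * t ^ (-1 - σ) * t ^ (-(τ - σ)) / Γ₀) *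
    (hxs - x ^ (-σ) * x ^ (-(τ - σ)) * hcs)

/-- **Tail of the generalized BFRY Lévy intensity at zero.** For `0 < σ < 1`, `τ > σ`,
`c > 0` and `ρ(w) = w^{−1−τ} γ(τ−σ, cw)/Γ(1−σ)`, the tail `ρ̄(x) = ∫_x^∞ ρ(w) dw`
satisfies `ρ̄(x) ~ (c^{τ−σ}/(σ(τ−σ)Γ(1−σ))) x^{−σ}` as `x → 0⁺`. -/
theorem gbfry_tail_levy_intensity_at_zero
    (σ τ c : ℝ) (hσ0 : 0 < σ) (hσ1 : σ < 1) (hτ : σ < τ) (hc : 0 < c) :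
    Tendsto
      (fun x : ℝ =>
        (∫ w in Set.Ioi x, w ^ (-1 - τ) * lowerIncGamma (τ - σ) (c * w) / Real.Gamma (1 - σ)) /
          (c ^ (τ - σ) / (σ * (τ - σ) * Real.Gamma (1 - σ)) * x ^ (-σ)))
      (nhdsWithin 0 (Set.Ioi 0)) (nhds 1) := by
  have hs : 0 < τ - σ := sub_pos.2 hτ
  have hΓ : 0 < Real.Gamma (1 - σ) := Real.Gamma_pos_of_pos (by linarith)
  have hlim := (tendsto_integral_rescaled_lowerIncGamma hσ0 hs hc).const_mul (σ * (τ - σ))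
  rw [mul_one_div_cancel (mul_pos hσ0 hs).ne'] at hlim
  refine hlim.congr' ?_
  filter_upwards [self_mem_nhdsWithin] with x hx
  have hcs := rpow_pos_of_pos hc (τ - σ)
  have hxs := rpow_pos_of_pos hx (-σ)
  rw [integral_gbfry_tail_eq hc hx]
  field_simp
end

section
/- Let 0 < σ < 1, τ > 0 with τ > σ, and c > 0, and let ρ(w) = (Γ(τ−σ)/Γ(1−σ)) w^{−1−σ}(c+w)^{σ−τ} for w > 0. Then the tail Lévy intensity ρ̄(x) = ∫_x^∞ ρ(w) dw satisfies ρ̄(x)/( (c^{σ−τ} Γ(τ−σ)/(σ Γ(1−σ))) x^{−σ} ) → 1 as x → 0⁺. -/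
open MeasureTheory Real Filter Set

/-- Rescaling the tail integral of `w ^ (-1 - σ) * (c + w) ^ p` to the half-line `(1, ∞)`. -/
lemma setIntegral_Ioi_rpow_mul_add_rpow {σ p c x : ℝ} (hx : 0 < x) :
    ∫ w in Set.Ioi x, w ^ (-1 - σ) * (c + w) ^ p =
      x ^ (-σ) * ∫ t in Set.Ioi (1 : ℝ), t ^ (-1 - σ) * (c + x * t) ^ p := by
  have hscale := integral_comp_mul_left_Ioi' (fun w : ℝ => w ^ (-1 - σ) * (c + w) ^ p) 1 hx
  rw [mul_one, smul_eq_mul] at hscale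
  rw [← hscale, ← integral_const_mul, ← integral_const_mul]
  refine setIntegral_congr_fun measurableSet_Ioi fun t ht => ?_
  have ht0 : (0 : ℝ) ≤ t := zero_le_one.trans (le_of_lt ht)
  have hpow : x * x ^ (-1 - σ) = x ^ (-σ) := by
    rw [show -σ = 1 + (-1 - σ) by ring, rpow_add hx, rpow_one]
  simp only [mul_rpow hx.le ht0, ← hpow]
  ring

/-- The rescaled tail integral converges as the scale tends to zero. -/
lemma tendsto_setIntegral_Ioi_one_rpow_mul_add_rpow {σ p c : ℝ} (hσ : 0 < σ) (hp : p ≤ 0)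
    (hc : 0 < c) :
    Tendsto (fun x : ℝ => ∫ t in Set.Ioi (1 : ℝ), t ^ (-1 - σ) * (c + x * t) ^ p)
      (nhdsWithin 0 (Set.Ioi 0)) (nhds (c ^ p / σ)) := by
  have hint : IntegrableOn (fun t : ℝ => t ^ (-1 - σ) * c ^ p) (Set.Ioi 1) :=
    (integrableOn_Ioi_rpow_of_lt (by linarith) one_pos).mul_const _
  have hval : ∫ t in Set.Ioi (1 : ℝ), t ^ (-1 - σ) * c ^ p = c ^ p / σ := by
    rw [integral_mul_const, integral_Ioi_rpow_of_lt (by linarith) one_pos, one_rpow,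
      show -1 - σ + 1 = -σ by ring, neg_div_neg_eq]
    ring
  rw [← hval]
  refine tendsto_integral_filter_of_dominated_convergence _
    (Eventually.of_forall fun x => by fun_prop) ?_ hint (Eventually.of_forall fun t => ?_)
  · filter_upwards [self_mem_nhdsWithin] with x (hx : 0 < x)
    filter_upwards [ae_restrict_mem measurableSet_Ioi] with t (ht : 1 < t)
    have ht0 : 0 < t := one_pos.trans ht
    have hxt : 0 < x * t := mul_pos hx ht0
    rw [norm_of_nonneg (by positivity)]
    exact mul_le_mul_of_nonneg_left (rpow_le_rpow_of_nonpos hc (by linarith) hp) (by positivity)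
  · have hcont : ContinuousAt (fun x : ℝ => t ^ (-1 - σ) * (c + x * t) ^ p) 0 := by
      refine continuousAt_const.mul (ContinuousAt.rpow_const (by fun_prop) (Or.inl ?_))
      simpa using hc.ne'
    simpa using hcont.tendsto.mono_left nhdsWithin_le_nhds

/-- **Tail of the beta prime Lévy intensity at zero.** For `0 < σ < 1`, `τ > 0` with
`τ > σ`, `c > 0` and `ρ(w) = (Γ(τ−σ)/Γ(1−σ)) w^{−1−σ}(c+w)^{σ−τ}`, the tail
`ρ̄(x) = ∫_x^∞ ρ(w) dw` satisfies
`ρ̄(x) ~ (c^{σ−τ} Γ(τ−σ)/(σ Γ(1−σ))) x^{−σ}` as `x → 0⁺`. -/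
theorem beta_prime_tail_levy_intensity_at_zero
    (σ τ c : ℝ) (hσ0 : 0 < σ) (hσ1 : σ < 1) (hτ0 : 0 < τ) (hστ : σ < τ) (hc : 0 < c) :
    Tendsto
      (fun x : ℝ =>
        (∫ w in Set.Ioi x,
            Real.Gamma (τ - σ) / Real.Gamma (1 - σ) * w ^ (-1 - σ) * (c + w) ^ (σ - τ)) /
          (c ^ (σ - τ) * Real.Gamma (τ - σ) / (σ * Real.Gamma (1 - σ)) * x ^ (-σ)))
      (nhdsWithin 0 (Set.Ioi 0)) (nhds 1) := by
  have hΓ₁ : 0 < Real.Gamma (τ - σ) := Gamma_pos_of_pos (by linarith)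
  have hΓ₂ : 0 < Real.Gamma (1 - σ) := Gamma_pos_of_pos (by linarith)
  have hcp : 0 < c ^ (σ - τ) := rpow_pos_of_pos hc _
  have hlim := (tendsto_setIntegral_Ioi_one_rpow_mul_add_rpow (p := σ - τ) hσ0 (by linarith)
    hc).div_const (c ^ (σ - τ) / σ)
  rw [div_self (by positivity)] at hlim
  refine hlim.congr' ?_
  filter_upwards [self_mem_nhdsWithin] with x (hx : 0 < x)
  have hxp : 0 < x ^ (-σ) := rpow_pos_of_pos hx _
  simp_rw [mul_assoc (Real.Gamma (τ - σ) / Real.Gamma (1 - σ))]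
  rw [integral_const_mul, setIntegral_Ioi_rpow_mul_add_rpow hx]
  field_simp
end

section
/- Let σ < 1, τ > max(0,σ) and c > 0. Then for every w > 0, (c^{τ−σ}/τ) ∫_0^1 z · ( (wz)^{−1−σ} e^{−c w z}/Γ(1−σ) ) · τ z^{τ−1} dz = w^{−1−τ} γ(τ−σ, cw)/Γ(1−σ). That is, the generalized BFRY Lévy density is the scale mixture of the generalized gamma process Lévy density ρ_GGP(·;σ,c) by a Beta(τ,1)-distributed divisor. -/
open MeasureTheory Real Filter Set

/-- Rescaling the integration variable to the unit interval:
`γ(s,x) = x^s ∫_0^1 z^{s−1} e^{−xz} dz` for `x > 0`. -/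
lemma lowerIncGamma_eq_rpow_mul_integral (s : ℝ) {x : ℝ} (hx : 0 < x) :
    lowerIncGamma s x = x ^ s * ∫ z in (0:ℝ)..1, z ^ (s - 1) * Real.exp (-(x * z)) := by
  have hscale := intervalIntegral.mul_integral_comp_mul_left (a := 0) (b := 1)
    (f := fun u : ℝ => u ^ (s - 1) * Real.exp (-u)) (c := x)
  rw [mul_zero, mul_one] at hscale
  rw [lowerIncGamma, ← hscale, ← intervalIntegral.integral_const_mul,
    ← intervalIntegral.integral_const_mul]
  refine intervalIntegral.integral_congr_uIoo fun z hz => ?_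
  rw [uIoo_of_le zero_le_one] at hz
  have hxs : x ^ s = x * x ^ (s - 1) := by
    rw [rpow_sub_one hx.ne', mul_div_cancel₀ _ hx.ne']
  simp only [mul_rpow hx.le hz.1.le, hxs]
  ring

/-- **The generalized BFRY Lévy density as a scale mixture.** For `σ < 1`, `τ > max(0,σ)`,
`c > 0` and every `w > 0`,
`(c^{τ−σ}/τ) ∫_0^1 z ((wz)^{−1−σ} e^{−cwz}/Γ(1−σ)) τ z^{τ−1} dz
  = w^{−1−τ} γ(τ−σ, cw)/Γ(1−σ)`,
i.e. the generalized BFRY Lévy density is the scale mixture of the GGP Lévy density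
`ρ_GGP(·;σ,c)` by a `Beta(τ,1)` divisor. -/
theorem gbfry_density_eq_scaled_ggp
    (σ τ c : ℝ) (hσ : σ < 1) (hτ : max 0 σ < τ) (hc : 0 < c) :
    ∀ w : ℝ, 0 < w →
      (c ^ (τ - σ) / τ) *
          ∫ z in (0:ℝ)..1,
            z * ((w * z) ^ (-1 - σ) * Real.exp (-(c * w * z)) / Real.Gamma (1 - σ)) *
              (τ * z ^ (τ - 1)) =
        w ^ (-1 - τ) * lowerIncGamma (τ - σ) (c * w) / Real.Gamma (1 - σ) := by
  intro w hw
  have hτ0 : τ ≠ 0 := ((le_max_left 0 σ).trans_lt hτ).ne'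
  have hintegral :
      ∫ z in (0:ℝ)..1,
          z * ((w * z) ^ (-1 - σ) * Real.exp (-(c * w * z)) / Real.Gamma (1 - σ)) *
            (τ * z ^ (τ - 1)) =
        τ * w ^ (-1 - σ) / Real.Gamma (1 - σ) *
          ∫ z in (0:ℝ)..1, z ^ (τ - σ - 1) * Real.exp (-(c * w * z)) := by
    rw [← intervalIntegral.integral_const_mul]
    refine intervalIntegral.integral_congr_uIoo fun z hz => ?_
    rw [uIoo_of_le zero_le_one] at hz
    have hz_pow : z ^ (τ - σ - 1) = z ^ (1:ℝ) * z ^ (-1 - σ) * z ^ (τ - 1) := by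
      rw [← rpow_add hz.1, ← rpow_add hz.1]
      ring_nf
    simp only [mul_rpow hw.le hz.1.le, hz_pow, rpow_one]
    ring
  have hw_pow : w ^ (-1 - σ) = w ^ (-1 - τ) * w ^ (τ - σ) := by
    rw [← rpow_add hw]
    ring_nf
  rw [hintegral, lowerIncGamma_eq_rpow_mul_integral _ (mul_pos hc hw),
    mul_rpow hc.le hw.le, hw_pow]
  field_simp
end

section
/- Let σ < 1 and τ > max(0,σ). Then for every w > 0, Γ(τ) ∫_0^∞ y · ( (wy)^{−1−σ} e^{−wy}/Γ(1−σ) ) · ( y^{τ−1} e^{−y}/Γ(τ) ) dy = (Γ(τ−σ)/Γ(1−σ)) w^{−1−σ}(1+w)^{σ−τ}. That is, the beta prime Lévy density with c = 1 is the scale mixture of the generalized gamma process Lévy density ρ_GGP(·;σ,1) by a Gamma(τ,1)-distributed divisor. -/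
open MeasureTheory Real Filter Set

/-- **The beta prime Lévy density (with `c = 1`) as a scale mixture.** For `σ < 1` and
`τ > max(0,σ)`, for every `w > 0`,
`Γ(τ) ∫_0^∞ y ((wy)^{−1−σ} e^{−wy}/Γ(1−σ)) (y^{τ−1} e^{−y}/Γ(τ)) dy
  = (Γ(τ−σ)/Γ(1−σ)) w^{−1−σ}(1+w)^{σ−τ}`,
i.e. the beta prime Lévy density with `c = 1` is the scale mixture of the GGP Lévy density
`ρ_GGP(·;σ,1)` by a `Gamma(τ,1)` divisor. -/
theorem beta_prime_density_eq_scaled_ggp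
    (σ τ : ℝ) (hσ : σ < 1) (hτ : max 0 σ < τ) :
    ∀ w : ℝ, 0 < w →
      Real.Gamma τ *
          ∫ y in Set.Ioi (0:ℝ),
            y * ((w * y) ^ (-1 - σ) * Real.exp (-(w * y)) / Real.Gamma (1 - σ)) *
              (y ^ (τ - 1) * Real.exp (-y) / Real.Gamma τ) =
        Real.Gamma (τ - σ) / Real.Gamma (1 - σ) * w ^ (-1 - σ) * (1 + w) ^ (σ - τ) := by
  intro w hw
  have hτ0 : 0 < τ := (le_max_left 0 σ).trans_lt hτ
  have hστ : 0 < τ - σ := sub_pos.mpr ((le_max_right 0 σ).trans_lt hτ)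
  have hw1 : 0 < 1 + w := by linarith
  have hΓ : Real.Gamma τ ≠ 0 := (Real.Gamma_pos_of_pos hτ0).ne'
  have hcongr : ∀ y ∈ Set.Ioi (0:ℝ),
      y * ((w * y) ^ (-1 - σ) * Real.exp (-(w * y)) / Real.Gamma (1 - σ)) *
          (y ^ (τ - 1) * Real.exp (-y) / Real.Gamma τ) =
        w ^ (-1 - σ) / (Real.Gamma (1 - σ) * Real.Gamma τ) *
          (y ^ (τ - σ - 1) * Real.exp (-((1 + w) * y))) := by
    intro y hy
    have hy0 : 0 < y := hy
    have hpow : y ^ (τ - σ - 1) = y * y ^ (-1 - σ) * y ^ (τ - 1) := by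
      nth_rewrite 2 [← Real.rpow_one y]
      rw [← Real.rpow_add hy0, ← Real.rpow_add hy0]
      ring_nf
    have hexp : Real.exp (-((1 + w) * y)) = Real.exp (-(w * y)) * Real.exp (-y) := by
      rw [← Real.exp_add]
      ring_nf
    rw [Real.mul_rpow hw.le hy0.le, hpow, hexp]
    ring
  rw [setIntegral_congr_fun measurableSet_Ioi hcongr, integral_const_mul,
    Real.integral_rpow_mul_exp_neg_mul_Ioi hστ hw1, one_div, Real.inv_rpow hw1.le,
    ← Real.rpow_neg hw1.le, neg_sub]
  field_simp
end

section
/- Let κ > 0, α > 0 and let 0 ≤ m < α be real. Then ∫_0^∞ w^m · (α/Γ(κ)) w^{−α−1} γ(κ+α, w) dw = α Γ(m+κ)/((α−m) Γ(κ)). In particular the m-th moment of the generalized BFRY distribution equals α Γ(m+κ)/((α−m) Γ(κ)) for m < α. -/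
open MeasureTheory Real Filter Set

/-- The Mellin-type integral of the lower incomplete gamma function. -/
theorem integral_rpow_mul_lowerIncGamma {s b : ℝ} (hb : 0 < b) (hbs : b < s) :
    ∫ w in Ioi (0:ℝ), w ^ (-b - 1) * lowerIncGamma s w = Real.Gamma (s - b) / b := by
  set μ : Measure ℝ := volume.restrict (Ioi 0) with hμ
  set F : ℝ → ℝ → ℝ := fun w u =>
    {p : ℝ × ℝ | p.2 < p.1}.indicator
      (fun p => p.1 ^ (-b - 1) * (p.2 ^ (s - 1) * Real.exp (-p.2))) (w, u) with hF
  have hFw : ∀ u, (fun w => F w u) =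
      (Ioi u).indicator (fun w => w ^ (-b - 1) * (u ^ (s - 1) * Real.exp (-u))) := by
    intro u
    ext w
    simp only [hF, indicator, mem_ofPred_eq, mem_Ioi]
  have hFu : ∀ w, (fun u => F w u) =
      (Iio w).indicator (fun u => w ^ (-b - 1) * (u ^ (s - 1) * Real.exp (-u))) := by
    intro w
    ext u
    simp only [hF, indicator, mem_ofPred_eq, mem_Iio]
  have hinner : ∀ u ∈ Ioi (0:ℝ), ∫ w, F w u ∂μ = Real.exp (-u) * u ^ (s - b - 1) / b := by
    intro u hu
    rw [mem_Ioi] at hu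
    rw [hFw, integral_indicator measurableSet_Ioi, hμ, Measure.restrict_restrict measurableSet_Ioi,
      inter_eq_left.mpr (Ioi_subset_Ioi hu.le), integral_mul_const,
      integral_Ioi_rpow_of_lt (by linarith) hu, sub_add_cancel, neg_div_neg_eq,
      show s - b - 1 = -b + (s - 1) by ring, Real.rpow_add hu]
    ring
  have hnonneg : ∀ u ∈ Ioi (0:ℝ), ∀ᵐ w ∂μ, ‖F w u‖ = F w u := by
    intro u hu
    filter_upwards [ae_restrict_mem measurableSet_Ioi] with w hw
    rw [Real.norm_of_nonneg]
    rw [mem_Ioi] at hu hw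
    exact indicator_apply_nonneg fun _ => by positivity
  have hmeas : Measurable (Function.uncurry F) := by
    have : Function.uncurry F = {p : ℝ × ℝ | p.2 < p.1}.indicator
        (fun p => p.1 ^ (-b - 1) * (p.2 ^ (s - 1) * Real.exp (-p.2))) := rfl
    rw [this]
    exact Measurable.indicator (by fun_prop) (measurableSet_lt measurable_snd measurable_fst)
  have hint : Integrable (Function.uncurry F) (μ.prod μ) := by
    refine (integrable_prod_iff' hmeas.aestronglyMeasurable).mpr ⟨?_, ?_⟩
    · filter_upwards [ae_restrict_mem measurableSet_Ioi] with u hu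
      simp only [Function.uncurry_apply_pair]
      rw [hFw]
      refine (integrable_indicator_iff measurableSet_Ioi).mpr (IntegrableOn.restrict ?_)
      exact (integrableOn_Ioi_rpow_of_lt (by linarith) hu).mul_const _
    · refine ((Real.GammaIntegral_convergent (sub_pos.mpr hbs)).div_const b).congr ?_
      filter_upwards [ae_restrict_mem measurableSet_Ioi] with u hu
      simp only [Function.uncurry_apply_pair]
      rw [integral_congr_ae (hnonneg u hu), hinner u hu]
  calc ∫ w in Ioi (0:ℝ), w ^ (-b - 1) * lowerIncGamma s w
      = ∫ w in Ioi (0:ℝ), ∫ u, F w u ∂μ := by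
        refine setIntegral_congr_fun measurableSet_Ioi fun w hw => ?_
        rw [mem_Ioi] at hw
        rw [hFu, integral_indicator measurableSet_Iio, hμ,
          Measure.restrict_restrict measurableSet_Iio, inter_comm, Ioi_inter_Iio,
          integral_const_mul, lowerIncGamma, intervalIntegral.integral_of_le hw.le,
          integral_Ioc_eq_integral_Ioo]
    _ = ∫ u in Ioi (0:ℝ), ∫ w, F w u ∂μ := integral_integral_swap hint
    _ = ∫ u in Ioi (0:ℝ), Real.exp (-u) * u ^ (s - b - 1) / b :=
        setIntegral_congr_fun measurableSet_Ioi hinner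
    _ = Real.Gamma (s - b) / b := by
        rw [integral_div, Real.Gamma_eq_integral (sub_pos.mpr hbs)]

/-- **Moments of the generalized BFRY distribution.** For `κ, α > 0` and real `0 ≤ m < α`,
`∫_0^∞ w^m (α/Γ(κ)) w^{−α−1} γ(κ+α, w) dw = α Γ(m+κ)/((α−m) Γ(κ))`. -/
theorem gbfry_distribution_moment
    (κ α m : ℝ) (hκ : 0 < κ) (hα : 0 < α) (hm0 : 0 ≤ m) (hmα : m < α) :
    ∫ w in Set.Ioi (0:ℝ),
        w ^ m * (α / Real.Gamma κ * w ^ (-α - 1) * lowerIncGamma (κ + α) w) =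
      α * Real.Gamma (m + κ) / ((α - m) * Real.Gamma κ) := by
  have h := integral_rpow_mul_lowerIncGamma (s := κ + α) (b := α - m) (by linarith) (by linarith)
  have hcongr : ∀ w ∈ Ioi (0:ℝ),
      w ^ m * (α / Real.Gamma κ * w ^ (-α - 1) * lowerIncGamma (κ + α) w) =
        α / Real.Gamma κ * (w ^ (-(α - m) - 1) * lowerIncGamma (κ + α) w) := by
    intro w hw
    rw [show -(α - m) - 1 = m + (-α - 1) by ring, Real.rpow_add hw]
    ring
  rw [setIntegral_congr_fun measurableSet_Ioi hcongr, integral_const_mul, h,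
    show κ + α - (α - m) = m + κ by ring, div_mul_div_comm, mul_comm (Real.Gamma κ)]
end

section
/- Let 0 < σ < 1, τ > σ, c > 0 and t > 0, and let ρ(w) = w^{−1−τ} γ(τ−σ, cw)/Γ(1−σ) for w > 0. Then ∫_0^∞ (1 − e^{−tw}) ρ(w) dw = (1/σ) ∫_0^c ((y+t)^σ − y^σ) y^{τ−σ−1} dy, and both integrals are finite. -/
open MeasureTheory Real Filter Set

/-- Tonelli's theorem for nonnegative real functions in terms of Bochner integrals. -/
lemma integrable_integral_and_integral_swap_of_nonneg {α β : Type*} [MeasurableSpace α]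
    [MeasurableSpace β] {μ : Measure α} {ν : Measure β} [SFinite μ] [SFinite ν] {f : α → β → ℝ}
    (hm : AEStronglyMeasurable (Function.uncurry f) (μ.prod ν))
    (h0 : ∀ᵐ x ∂μ, ∀ᵐ y ∂ν, 0 ≤ f x y) (hi : ∀ᵐ x ∂μ, Integrable (f x) ν)
    (hI : Integrable (fun x => ∫ y, f x y ∂ν) μ) :
    Integrable (fun y => ∫ x, f x y ∂μ) ν ∧
      ∫ y, ∫ x, f x y ∂μ ∂ν = ∫ x, ∫ y, f x y ∂ν ∂μ := by
  have h : Integrable (Function.uncurry f) (μ.prod ν) := by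
    refine (integrable_prod_iff hm).2 ⟨hi, hI.congr ?_⟩
    filter_upwards [h0] with x hx
    refine integral_congr_ae ?_
    filter_upwards [hx] with y hy
    exact (Real.norm_of_nonneg hy).symm
  exact ⟨h.integral_prod_right, (integral_integral_swap h).symm⟩

lemma integral_exp_neg_mul_Ioc (y w : ℝ) {t : ℝ} (ht : 0 ≤ t) (hw : w ≠ 0) :
    ∫ s in Ioc y (y + t), Real.exp (-(s * w)) =
      (Real.exp (-(y * w)) - Real.exp (-((y + t) * w))) / w := by
  rw [← intervalIntegral.integral_of_le (by linarith)]
  rw [intervalIntegral.integral_eq_sub_of_hasDerivAt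
    (f := fun s => -(Real.exp (-(s * w)) / w))]
  · ring
  · intro s _
    have h := ((((hasDerivAt_id s).mul_const w).neg.exp).div_const w).neg
    refine h.congr_deriv ?_
    simp only [Pi.neg_apply, id]
    field_simp
  · exact Continuous.intervalIntegrable (by fun_prop) _ _

lemma integrableOn_and_integral_exp_sub_exp_mul_rpow {σ y t : ℝ} (hσ0 : 0 < σ) (hσ1 : σ < 1)
    (hy : 0 < y) (ht : 0 ≤ t) :
    IntegrableOn (fun w => (Real.exp (-(y * w)) - Real.exp (-((y + t) * w))) * w ^ (-1 - σ))
      (Ioi 0) ∧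
    ∫ w in Ioi (0 : ℝ), (Real.exp (-(y * w)) - Real.exp (-((y + t) * w))) * w ^ (-1 - σ) =
      Real.Gamma (1 - σ) * (((y + t) ^ σ - y ^ σ) / σ) := by
  have hin : ∀ s ∈ Ioc y (y + t), ∫ w in Ioi (0 : ℝ), w ^ (-σ) * Real.exp (-(s * w)) =
      Real.Gamma (1 - σ) * s ^ (σ - 1) := by
    intro s hs
    have hs0 : 0 < s := hy.trans hs.1
    have h := Real.integral_rpow_mul_exp_neg_mul_Ioi (a := 1 - σ) (by linarith) hs0
    rw [show 1 - σ - 1 = -σ by ring] at h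
    rw [h, one_div, Real.inv_rpow hs0.le, ← Real.rpow_neg hs0.le, neg_sub, mul_comm]
  have hint : IntervalIntegrable (fun s : ℝ => s ^ (σ - 1)) volume y (y + t) :=
    intervalIntegral.intervalIntegrable_rpow' (by linarith)
  have hout : ∀ w ∈ Ioi (0 : ℝ), ∫ s in Ioc y (y + t), w ^ (-σ) * Real.exp (-(s * w)) =
      (Real.exp (-(y * w)) - Real.exp (-((y + t) * w))) * w ^ (-1 - σ) := by
    intro w hw
    have hw0 : 0 < w := hw
    rw [integral_const_mul, integral_exp_neg_mul_Ioc y w ht hw0.ne',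
      show -1 - σ = -σ - 1 by ring, Real.rpow_sub_one hw0.ne']
    ring
  obtain ⟨h1, h2⟩ := integrable_integral_and_integral_swap_of_nonneg
    (μ := volume.restrict (Ioc y (y + t))) (ν := volume.restrict (Ioi (0 : ℝ)))
    (f := fun s w => w ^ (-σ) * Real.exp (-(s * w)))
    (Measurable.aestronglyMeasurable (by unfold Function.uncurry; fun_prop))
    (by
      refine ae_of_all _ fun s => ?_
      filter_upwards [ae_restrict_mem measurableSet_Ioi] with w hw
      have hw0 : 0 < w := hw
      positivity)
    (by
      filter_upwards [ae_restrict_mem measurableSet_Ioc] with s hs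
      have h := integrableOn_rpow_mul_exp_neg_mul_rpow (p := 1) (s := -σ) (b := s)
        (by linarith) one_pos (hy.trans hs.1)
      simpa [IntegrableOn] using h)
    (by
      refine IntegrableOn.congr_fun (f := fun s => Real.Gamma (1 - σ) * s ^ (σ - 1)) ?_
        (fun s hs => (hin s hs).symm) measurableSet_Ioc
      exact (((intervalIntegrable_iff_integrableOn_Ioc_of_le (by linarith)).1 hint).const_mul _))
  refine ⟨IntegrableOn.congr_fun h1 hout measurableSet_Ioi, ?_⟩
  rw [← setIntegral_congr_fun measurableSet_Ioi hout, h2,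
    setIntegral_congr_fun measurableSet_Ioc hin, integral_const_mul,
    ← intervalIntegral.integral_of_le (by linarith), integral_rpow (Or.inl (by linarith))]
  simp

lemma lowerIncGamma_mul (s : ℝ) {c w : ℝ} (hc : 0 ≤ c) (hw : 0 < w) :
    lowerIncGamma s (c * w) = w ^ s * ∫ y in Ioc 0 c, y ^ (s - 1) * Real.exp (-(y * w)) := by
  have h := intervalIntegral.integral_comp_mul_right (a := 0) (b := c)
    (fun u => u ^ (s - 1) * Real.exp (-u)) hw.ne'
  rw [zero_mul, smul_eq_mul, eq_inv_mul_iff_mul_eq₀ hw.ne'] at h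
  rw [lowerIncGamma, ← h, intervalIntegral.integral_of_le hc, ← integral_const_mul,
    ← integral_const_mul]
  refine setIntegral_congr_fun measurableSet_Ioc fun y hy => ?_
  rw [Real.mul_rpow hy.1.le hw.le, Real.rpow_sub_one hw.ne' s]
  field_simp

lemma integrableOn_add_rpow_sub_rpow_mul_rpow {σ s c t : ℝ} (hσ0 : 0 ≤ σ) (hs : 0 < s)
    (hc : 0 ≤ c) :
    IntegrableOn (fun y => ((y + t) ^ σ - y ^ σ) * y ^ (s - 1)) (Ioc 0 c) := by
  rw [← intervalIntegrable_iff_integrableOn_Ioc_of_le hc]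
  refine IntervalIntegrable.continuousOn_mul
    (intervalIntegral.intervalIntegrable_rpow' (by linarith)) (Continuous.continuousOn ?_)
  exact ((continuous_id.add continuous_const).rpow_const fun _ => Or.inr hσ0).sub
    (continuous_id.rpow_const fun _ => Or.inr hσ0)

/-- **Laplace exponent of the generalized BFRY process.** For `0 < σ < 1`, `τ > σ`, `c > 0`,
`t > 0` and `ρ(w) = w^{−1−τ} γ(τ−σ, cw)/Γ(1−σ)`,
`∫_0^∞ (1 − e^{−tw}) ρ(w) dw = (1/σ) ∫_0^c ((y+t)^σ − y^σ) y^{τ−σ−1} dy`,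
and both integrals are finite. -/
theorem gbfry_laplace_exponent
    (σ τ c t : ℝ) (hσ0 : 0 < σ) (hσ1 : σ < 1) (hτ : σ < τ) (hc : 0 < c) (ht : 0 < t) :
    IntegrableOn
      (fun w => (1 - Real.exp (-(t * w))) *
        (w ^ (-1 - τ) * lowerIncGamma (τ - σ) (c * w) / Real.Gamma (1 - σ)))
      (Set.Ioi 0) ∧
    IntegrableOn
      (fun y => ((y + t) ^ σ - y ^ σ) * y ^ (τ - σ - 1)) (Set.Ioc 0 c) ∧
    ∫ w in Set.Ioi (0:ℝ),
        (1 - Real.exp (-(t * w))) *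
          (w ^ (-1 - τ) * lowerIncGamma (τ - σ) (c * w) / Real.Gamma (1 - σ)) =
      (1 / σ) * ∫ y in Set.Ioc (0:ℝ) c, ((y + t) ^ σ - y ^ σ) * y ^ (τ - σ - 1) := by
  have hG : 0 < Real.Gamma (1 - σ) := Real.Gamma_pos_of_pos (by linarith)
  have hrhs := integrableOn_add_rpow_sub_rpow_mul_rpow (t := t) hσ0.le (sub_pos.2 hτ) hc.le
  have hin : ∀ y ∈ Ioc 0 c, ∫ w in Ioi (0 : ℝ), y ^ (τ - σ - 1) / Real.Gamma (1 - σ) *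
      ((Real.exp (-(y * w)) - Real.exp (-((y + t) * w))) * w ^ (-1 - σ)) =
      1 / σ * (((y + t) ^ σ - y ^ σ) * y ^ (τ - σ - 1)) := by
    intro y hy
    rw [integral_const_mul,
      (integrableOn_and_integral_exp_sub_exp_mul_rpow hσ0 hσ1 hy.1 ht.le).2]
    field_simp
  have hout : ∀ w ∈ Ioi (0 : ℝ), ∫ y in Ioc 0 c, y ^ (τ - σ - 1) / Real.Gamma (1 - σ) *
      ((Real.exp (-(y * w)) - Real.exp (-((y + t) * w))) * w ^ (-1 - σ)) =
      (1 - Real.exp (-(t * w))) *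
        (w ^ (-1 - τ) * lowerIncGamma (τ - σ) (c * w) / Real.Gamma (1 - σ)) := by
    intro w hw
    have hw0 : 0 < w := hw
    rw [lowerIncGamma_mul _ hc.le hw0, ← mul_assoc (w ^ (-1 - τ)), ← Real.rpow_add hw0,
      show -1 - τ + (τ - σ) = -1 - σ by ring, mul_div_right_comm, ← mul_assoc,
      ← integral_const_mul]
    refine setIntegral_congr_fun measurableSet_Ioc fun y _ => ?_
    rw [show -((y + t) * w) = -(y * w) + -(t * w) by ring, Real.exp_add]
    ring
  obtain ⟨h1, h2⟩ := integrable_integral_and_integral_swap_of_nonneg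
    (μ := volume.restrict (Ioc 0 c)) (ν := volume.restrict (Ioi (0 : ℝ)))
    (f := fun y w => y ^ (τ - σ - 1) / Real.Gamma (1 - σ) *
      ((Real.exp (-(y * w)) - Real.exp (-((y + t) * w))) * w ^ (-1 - σ)))
    (Measurable.aestronglyMeasurable (by unfold Function.uncurry; fun_prop))
    (by
      filter_upwards [ae_restrict_mem measurableSet_Ioc] with y hy
      filter_upwards [ae_restrict_mem measurableSet_Ioi] with w hw
      have hw0 : 0 < w := hw
      have hy0 : 0 < y := hy.1
      have hle : Real.exp (-((y + t) * w)) ≤ Real.exp (-(y * w)) :=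
        Real.exp_le_exp.2 (by nlinarith)
      exact mul_nonneg (by positivity) (mul_nonneg (sub_nonneg.2 hle) (by positivity)))
    (by
      filter_upwards [ae_restrict_mem measurableSet_Ioc] with y hy
      exact (integrableOn_and_integral_exp_sub_exp_mul_rpow hσ0 hσ1 hy.1 ht.le).1.const_mul _)
    (IntegrableOn.congr_fun (hrhs.const_mul (1 / σ)) (fun y hy => (hin y hy).symm)
      measurableSet_Ioc)
  refine ⟨IntegrableOn.congr_fun h1 hout measurableSet_Ioi, hrhs, ?_⟩
  rw [← setIntegral_congr_fun measurableSet_Ioi hout, h2,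
    setIntegral_congr_fun measurableSet_Ioc hin, integral_const_mul]
end

section
/- Let σ < 1, τ > max(0,σ), t > 0 and let m > σ be real, and let ρ(w) = (Γ(τ−σ)/Γ(1−σ)) w^{−1−σ}(1+w)^{σ−τ} for w > 0 (the beta prime Lévy density with c = 1). Then ∫_0^∞ w^m e^{−tw} ρ(w) dw = (Γ(m−σ)/Γ(1−σ)) ∫_0^∞ y^{τ−σ−1} e^{−y} (y+t)^{σ−m} dy, and both integrals are finite. -/
open MeasureTheory Real Filter Set

/-- The kernel `w ^ (b - 1) * y ^ (a - 1) * exp (-t w - y - w y)`, whose two partial integrals over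
`(0, ∞)` are Gamma integrals. -/
noncomputable def gammaKernel (a b t w y : ℝ) : ℝ :=
  w ^ (b - 1) * Real.exp (-(t * w)) * (y ^ (a - 1) * Real.exp (-((1 + w) * y)))

theorem integrableOn_rpow_mul_exp_neg_mul {a r : ℝ} (ha : 0 < a) (hr : 0 < r) :
    IntegrableOn (fun x : ℝ => x ^ (a - 1) * Real.exp (-(r * x))) (Ioi 0) := by
  simpa using integrableOn_rpow_mul_exp_neg_mul_rpow (p := 1) (s := a - 1) (by linarith)
    one_pos hr

theorem integrable_gammaKernel {a b t : ℝ} (ha : 0 < a) (hb : 0 < b) (ht : 0 < t) :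
    Integrable (Function.uncurry (gammaKernel a b t))
      ((volume.restrict (Ioi 0)).prod (volume.restrict (Ioi 0))) := by
  refine ((integrableOn_rpow_mul_exp_neg_mul hb ht).mul_prod
    (integrableOn_rpow_mul_exp_neg_mul ha one_pos)).mono ?_ ?_
  · refine Measurable.aestronglyMeasurable ?_
    unfold gammaKernel Function.uncurry
    fun_prop
  · rw [Measure.prod_restrict]
    filter_upwards [ae_restrict_mem (measurableSet_Ioi.prod measurableSet_Ioi)] with ⟨w, y⟩ hwy
    have hw : 0 < w := hwy.1
    have hy : 0 < y := hwy.2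
    simp only [Function.uncurry_apply_pair, gammaKernel]
    rw [Real.norm_of_nonneg (by positivity), Real.norm_of_nonneg (by positivity)]
    gcongr
    linarith

theorem integral_gammaKernel_right {a b t w : ℝ} (ha : 0 < a) (hw : 0 < w) :
    ∫ y in Ioi 0, gammaKernel a b t w y =
      w ^ (b - 1) * Real.exp (-(t * w)) * (Real.Gamma a * (1 + w) ^ (-a)) := by
  have h1 : 0 < 1 + w := by linarith
  simp only [gammaKernel]
  rw [integral_const_mul, Real.integral_rpow_mul_exp_neg_mul_Ioi ha h1, one_div,
    Real.inv_rpow h1.le, ← Real.rpow_neg h1.le, mul_comm (Real.Gamma a)]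

theorem integral_gammaKernel_left {a b t y : ℝ} (hb : 0 < b) (ht : 0 < t) (hy : 0 < y) :
    ∫ w in Ioi 0, gammaKernel a b t w y =
      Real.Gamma b * (y ^ (a - 1) * Real.exp (-y) * (y + t) ^ (-b)) := by
  have h1 : 0 < y + t := by linarith
  have h : ∀ w, gammaKernel a b t w y =
      y ^ (a - 1) * Real.exp (-y) * (w ^ (b - 1) * Real.exp (-((y + t) * w))) := fun w => by
    have : Real.exp (-(t * w)) * Real.exp (-((1 + w) * y)) =
        Real.exp (-y) * Real.exp (-((y + t) * w)) := by
      rw [← Real.exp_add, ← Real.exp_add]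
      ring_nf
    rw [gammaKernel]
    linear_combination w ^ (b - 1) * y ^ (a - 1) * this
  simp only [h]
  rw [integral_const_mul, Real.integral_rpow_mul_exp_neg_mul_Ioi hb h1, one_div,
    Real.inv_rpow h1.le, ← Real.rpow_neg h1.le]
  ring

/-- **Moment integral of the beta prime Lévy density (with `c = 1`).** For `σ < 1`,
`τ > max(0,σ)`, `t > 0`, real `m > σ` and `ρ(w) = (Γ(τ−σ)/Γ(1−σ)) w^{−1−σ}(1+w)^{σ−τ}`,
`∫_0^∞ w^m e^{−tw} ρ(w) dw = (Γ(m−σ)/Γ(1−σ)) ∫_0^∞ y^{τ−σ−1} e^{−y} (y+t)^{σ−m} dy`,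
and both integrals are finite. -/
theorem beta_prime_kappa_integral
    (σ τ t m : ℝ) (hσ : σ < 1) (hτ : max 0 σ < τ) (ht : 0 < t) (hm : σ < m) :
    IntegrableOn
      (fun w => w ^ m * Real.exp (-(t * w)) *
        (Real.Gamma (τ - σ) / Real.Gamma (1 - σ) * w ^ (-1 - σ) * (1 + w) ^ (σ - τ)))
      (Set.Ioi 0) ∧
    IntegrableOn (fun y => y ^ (τ - σ - 1) * Real.exp (-y) * (y + t) ^ (σ - m)) (Set.Ioi 0) ∧
    ∫ w in Set.Ioi (0:ℝ),
        w ^ m * Real.exp (-(t * w)) *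
          (Real.Gamma (τ - σ) / Real.Gamma (1 - σ) * w ^ (-1 - σ) * (1 + w) ^ (σ - τ)) =
      Real.Gamma (m - σ) / Real.Gamma (1 - σ) *
        ∫ y in Set.Ioi (0:ℝ), y ^ (τ - σ - 1) * Real.exp (-y) * (y + t) ^ (σ - m) := by
  have ha : 0 < τ - σ := sub_pos.2 ((le_max_right _ _).trans_lt hτ)
  have hb : 0 < m - σ := sub_pos.2 hm
  have hΓ : Real.Gamma (m - σ) ≠ 0 := (Real.Gamma_pos_of_pos hb).ne'
  have hK := integrable_gammaKernel ha hb ht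
  have hL : ∀ w ∈ Ioi (0 : ℝ),
      (Real.Gamma (1 - σ))⁻¹ * ∫ y in Ioi 0, gammaKernel (τ - σ) (m - σ) t w y =
      w ^ m * Real.exp (-(t * w)) *
        (Real.Gamma (τ - σ) / Real.Gamma (1 - σ) * w ^ (-1 - σ) * (1 + w) ^ (σ - τ)) := by
    intro w hw
    rw [integral_gammaKernel_right ha hw, show m - σ - 1 = m + (-1 - σ) by ring,
      Real.rpow_add hw, neg_sub]
    ring
  have hR : ∀ y ∈ Ioi (0 : ℝ),
      (Real.Gamma (m - σ))⁻¹ * ∫ w in Ioi 0, gammaKernel (τ - σ) (m - σ) t w y =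
      y ^ (τ - σ - 1) * Real.exp (-y) * (y + t) ^ (σ - m) := by
    intro y hy
    rw [integral_gammaKernel_left hb ht hy, inv_mul_cancel_left₀ hΓ, neg_sub]
  refine ⟨IntegrableOn.congr_fun (hK.integral_prod_left.const_mul _) hL measurableSet_Ioi,
    IntegrableOn.congr_fun (hK.integral_prod_right.const_mul _) hR measurableSet_Ioi, ?_⟩
  rw [← setIntegral_congr_fun measurableSet_Ioi hL, ← setIntegral_congr_fun measurableSet_Ioi hR,
    integral_const_mul, integral_const_mul, integral_integral_swap hK]
  field_simp
end
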